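/- arXiv:2005.05913 — 4 statements merged into one kernel-verified Lean document; each statement's English description precedes it below -/
import Mathlib

section
/- Let n ≥ 3 be an integer and let q ∈ [2, ∞) be real. Let e be a random vector uniformly distributed on the Euclidean unit sphere S^{n-1} = {x ∈ ℝ^n : ‖x‖₂ = 1}. Then (E[‖e‖_q⁴])^{1/2} ≤ min{2q − 1, 32·log n − 8} · n^{2/q − 1}. -/
open MeasureTheory ProbabilityTheory

/-- The `ℓ_q` norm of a vector in `ℝ^n`, for real `q ∈ [1, ∞)`. -/
noncomputable def lpnorm {n : ℕ} (q : ℝ) (x : Fin n → ℝ) : ℝ :=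
  (∑ i, |x i| ^ q) ^ (1 / q)

lemma refl_mem {n : ℕ} (v : Fin n → ℝ) (hv : v ⬝ᵥ v = 1) :
    (1 - (2:ℝ) • Matrix.vecMulVec v v) ∈ Matrix.orthogonalGroup (Fin n) ℝ := by
  rw [Matrix.mem_orthogonalGroup_iff]
  have h1 : Matrix.transpose (1 - (2:ℝ) • Matrix.vecMulVec v v) = (1 - (2:ℝ) • Matrix.vecMulVec v v) := by
    ext a b
    simp [Matrix.vecMulVec_apply, Matrix.one_apply, eq_comm, mul_comm]
  rw [h1]
  have h2 : Matrix.vecMulVec v v * Matrix.vecMulVec v v = Matrix.vecMulVec v v := by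
    rw [Matrix.vecMulVec_mul_vecMulVec, hv, one_smul]
  simp only [sub_mul, mul_sub, one_mul, mul_one, smul_mul_assoc, mul_smul_comm, h2]
  module

lemma exists_refl {n : ℕ} (i j : Fin n) (hij : i ≠ j) (t : ℝ) :
    ∃ O ∈ Matrix.orthogonalGroup (Fin n) ℝ, ∀ x : Fin n → ℝ,
      Matrix.mulVec O x i = -(Real.cos t * x i + Real.sin t * x j) ∧
      Matrix.mulVec O x j = -Real.sin t * x i + Real.cos t * x j := by
  set v : Fin n → ℝ := Pi.single i (Real.cos (t/2)) + Pi.single j (Real.sin (t/2)) with hvd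
  have hc := Real.cos_sq_add_sin_sq (t/2)
  have hvi : v i = Real.cos (t/2) := by simp [hvd, hij]
  have hvj : v j = Real.sin (t/2) := by simp [hvd, hij.symm]
  have hd : ∀ x : Fin n → ℝ, v ⬝ᵥ x = Real.cos (t/2) * x i + Real.sin (t/2) * x j := by
    intro x; simp [hvd, add_dotProduct]
  refine ⟨_, refl_mem v ?_, fun x => ?_⟩
  · rw [hd, hvi, hvj]; linarith
  · have e1 : Real.cos t = 2 * Real.cos (t/2)^2 - 1 := by
      rw [← Real.cos_two_mul]; ring_nf
    have e2 : Real.sin t = 2 * Real.sin (t/2) * Real.cos (t/2) := by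
      rw [← Real.sin_two_mul]; ring_nf
    have e3 : Real.sin (t/2)^2 = 1 - Real.cos (t/2)^2 := by linarith
    simp only [Matrix.sub_mulVec, Matrix.one_mulVec, Matrix.smul_mulVec, Matrix.vecMulVec_mulVec,
      hd, Pi.sub_apply, Pi.smul_apply, hvi, hvj, e1, e2, smul_eq_mul, MulOpposite.smul_eq_mul_unop,
      MulOpposite.unop_op]
    constructor
    · ring
    · linear_combination (-2 * x j) * e3

lemma abs_le_one_of {n : ℕ} {x : Fin n → ℝ} (h : ∑ i, (x i) ^ 2 = 1) (i : Fin n) : |x i| ≤ 1 := by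
  have : x i ^ 2 ≤ ∑ i, (x i) ^ 2 :=
    Finset.single_le_sum (f := fun i => x i ^ 2) (fun _ _ => sq_nonneg _) (Finset.mem_univ i)
  rw [h] at this
  exact (sq_le_one_iff_abs_le_one _).1 this

lemma integ {n : ℕ} (μ : Measure (Fin n → ℝ)) [IsProbabilityMeasure μ]
    (hsphere : ∀ᵐ x ∂μ, ∑ i, (x i) ^ 2 = 1) (i j : Fin n) (a b : ℕ) :
    Integrable (fun x => x i ^ a * x j ^ b) μ := by
  refine Integrable.of_bound (C := 1) (by fun_prop) ?_
  filter_upwards [hsphere] with x hx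
  rw [Real.norm_eq_abs, abs_mul, abs_pow, abs_pow]
  exact mul_le_one₀ (pow_le_one₀ (abs_nonneg _) (abs_le_one_of hx i)) (by positivity)
    (pow_le_one₀ (abs_nonneg _) (abs_le_one_of hx j))

lemma key {n : ℕ} (μ : Measure (Fin n → ℝ)) [IsProbabilityMeasure μ]
    (hsphere : ∀ᵐ x ∂μ, ∑ i, (x i) ^ 2 = 1)
    (hrot : ∀ O ∈ Matrix.orthogonalGroup (Fin n) ℝ,
      Measure.map (fun x => Matrix.mulVec O x) μ = μ) (i j : Fin n) (hij : i ≠ j) (k : ℕ) :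
    ∫ x, x i ^ (2 * k + 2) ∂μ = (2 * k + 1) * ∫ x, x i ^ (2 * k) * x j ^ 2 ∂μ := by
  set F : ℝ → (Fin n → ℝ) → ℝ := fun t x =>
    (Real.cos t * x i + Real.sin t * x j) ^ (2*k+1) * (-Real.sin t * x i + Real.cos t * x j) with hF
  set F' : ℝ → (Fin n → ℝ) → ℝ := fun t x =>
    (2*k+1) * (Real.cos t * x i + Real.sin t * x j) ^ (2*k) *
      (-Real.sin t * x i + Real.cos t * x j)^2 - (Real.cos t * x i + Real.sin t * x j) ^ (2*k+2)
    with hF'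
  have hconst : ∀ t, ∫ x, F t x ∂μ = - ∫ x, x i ^ (2*k+1) * x j ∂μ := by
    intro t
    obtain ⟨O, hO, hx⟩ := exists_refl i j hij t
    rw [← hrot O hO, integral_map (by fun_prop) (by fun_prop), hrot O hO, ← integral_neg]
    refine integral_congr_ae (Filter.Eventually.of_forall fun x => ?_)
    simp only [(hx x).1, (hx x).2, hF]
    have hcs := Real.cos_sq_add_sin_sq t
    have a1 : Real.cos t * -(Real.cos t * x i + Real.sin t * x j) +
        Real.sin t * (-Real.sin t * x i + Real.cos t * x j) = -x i := by
      linear_combination (-x i) * hcs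
    have a2 : -Real.sin t * -(Real.cos t * x i + Real.sin t * x j) +
        Real.cos t * (-Real.sin t * x i + Real.cos t * x j) = x j := by
      linear_combination (x j) * hcs
    rw [a1, a2, Odd.neg_pow ⟨k, rfl⟩]
    ring
  have hb : ∀ (t : ℝ) (x : Fin n → ℝ), (∑ i, (x i) ^ 2 = 1) → |Real.cos t * x i + Real.sin t * x j| ≤ 2 ∧
      |-Real.sin t * x i + Real.cos t * x j| ≤ 2 := by
    intro t x hx
    have h1 := abs_le_one_of hx i
    have h2 := abs_le_one_of hx j
    have h3 := Real.abs_cos_le_one t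
    have h4 := Real.abs_sin_le_one t
    have m : ∀ a b : ℝ, |a| ≤ 1 → |b| ≤ 1 → |a * b| ≤ 1 := fun a b ha hb => by
      rw [abs_mul]; exact mul_le_one₀ ha (abs_nonneg _) hb
    constructor
    · refine (abs_add_le _ _).trans ?_
      linarith [m _ _ h3 h1, m _ _ h4 h2]
    · refine (abs_add_le _ _).trans ?_
      linarith [m _ _ (by rwa [abs_neg] : |-Real.sin t| ≤ 1) h1, m _ _ h3 h2]
  have hD := hasDerivAt_integral_of_dominated_loc_of_deriv_le (μ := μ) (F := F) (F' := F')
    (x₀ := 0) (s := Set.univ) (bound := fun _ => (2*k+1) * 2^(2*k) * 2^2 + 2^(2*k+2))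
    Filter.univ_mem (Filter.Eventually.of_forall fun t => by simp only [hF]; fun_prop)
    (by
      simp only [hF]
      have := integ μ hsphere i j (2*k+1) 1
      simpa using this) (by simp only [hF']; fun_prop)
    (by
      filter_upwards [hsphere] with x hx t _
      obtain ⟨h1, h2⟩ := hb t x hx
      simp only [hF']
      rw [Real.norm_eq_abs]
      refine (abs_sub _ _).trans ?_
      rw [abs_mul, abs_mul, abs_pow, abs_pow, abs_pow, abs_of_nonneg (by positivity : (0:ℝ) ≤ 2*k+1)]
      gcongr)
    (integrable_const _)
    (by
      refine Filter.Eventually.of_forall fun x t _ => ?_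
      have h1 : HasDerivAt (fun t => Real.cos t * x i + Real.sin t * x j)
        (-Real.sin t * x i + Real.cos t * x j) t :=
        ((Real.hasDerivAt_cos t).mul_const _).add ((Real.hasDerivAt_sin t).mul_const _)
      have h2 : HasDerivAt (fun t => -Real.sin t * x i + Real.cos t * x j)
        (-Real.cos t * x i + -Real.sin t * x j) t :=
        (((Real.hasDerivAt_sin t).neg).mul_const _).add ((Real.hasDerivAt_cos t).mul_const _)
      have h3 := (h1.pow (2*k+1)).mul h2
      refine HasDerivAt.congr_deriv h3 ?_
      simp only [hF', Pi.pow_apply, Nat.add_sub_cancel]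
      push_cast
      ring)
  have h0 := hD.2
  rw [show (fun t => ∫ x, F t x ∂μ) = fun _ => - ∫ x, x i ^ (2*k+1) * x j ∂μ from funext hconst] at h0
  have h00 := h0.unique (hasDerivAt_const _ _)
  simp only [hF', Real.cos_zero, Real.sin_zero, one_mul, zero_mul, add_zero, neg_zero, zero_add,
    mul_assoc] at h00
  have i1 := (integ μ hsphere i j (2*k) 2).const_mul (2*(k:ℝ)+1)
  have i2 := integ μ hsphere i j (2*k+2) 0
  simp only [pow_zero, mul_one] at i2
  rw [integral_sub i1 i2, integral_const_mul] at h00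
  linarith

lemma recur {n : ℕ} (μ : Measure (Fin n → ℝ)) [IsProbabilityMeasure μ]
    (hsphere : ∀ᵐ x ∂μ, ∑ i, (x i) ^ 2 = 1)
    (hrot : ∀ O ∈ Matrix.orthogonalGroup (Fin n) ℝ,
      Measure.map (fun x => Matrix.mulVec O x) μ = μ) (i : Fin n) (k : ℕ) :
    n * ∫ x, x i ^ (2 * k + 2) ∂μ ≤ (2 * k + 1) * ∫ x, x i ^ (2 * k) ∂μ := by
  have h1 : ∫ x, x i ^ (2 * k) ∂μ = ∑ j, ∫ x, x i ^ (2 * k) * x j ^ 2 ∂μ := by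
    rw [← integral_finsetSum _ (fun j _ => integ μ hsphere i j (2*k) 2)]
    refine integral_congr_ae ?_
    filter_upwards [hsphere] with x hx
    rw [← Finset.mul_sum, hx, mul_one]
  have h2 : ∀ j, ∫ x, x i ^ (2 * k + 2) ∂μ ≤ (2 * k + 1) * ∫ x, x i ^ (2 * k) * x j ^ 2 ∂μ := by
    intro j
    by_cases hij : i = j
    · subst hij
      simp only [← pow_add]
      have : 0 ≤ ∫ x, x i ^ (2 * k + 2) ∂μ :=
        integral_nonneg fun x => Even.pow_nonneg ⟨k+1, by ring⟩ _
      nlinarith [(Nat.cast_nonneg k : (0:ℝ) ≤ k)]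
    · exact (key μ hsphere hrot i j hij k).le
  rw [h1, Finset.mul_sum]
  calc _ = ∑ j : Fin n, ∫ x, x i ^ (2 * k + 2) ∂μ := by simp
    _ ≤ _ := Finset.sum_le_sum fun j _ => h2 j

lemma moment {n : ℕ} (hn : 0 < n) (μ : Measure (Fin n → ℝ)) [IsProbabilityMeasure μ]
    (hsphere : ∀ᵐ x ∂μ, ∑ i, (x i) ^ 2 = 1)
    (hrot : ∀ O ∈ Matrix.orthogonalGroup (Fin n) ℝ,
      Measure.map (fun x => Matrix.mulVec O x) μ = μ) (i : Fin n) (k : ℕ) :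
    ∀ l, l ≤ k → ∫ x, x i ^ (2 * l) ∂μ ≤ ((2 * k - 1) / n : ℝ) ^ l := by
  have hn' : (0:ℝ) < n := by exact_mod_cast hn
  intro l
  induction l with
  | zero => intro _; simp
  | succ l ih =>
    intro hl
    have h1 := ih (by omega)
    have h2 := recur μ hsphere hrot i l
    have h3 : (l:ℝ) + 1 ≤ k := by exact_mod_cast hl
    have h4 : 0 ≤ ∫ x, x i ^ (2 * l) ∂μ := integral_nonneg fun x => Even.pow_nonneg ⟨l, by ring⟩ _
    have h5 : (0:ℝ) ≤ l := Nat.cast_nonneg l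
    rw [show 2 * (l+1) = 2 * l + 2 by ring, pow_succ]
    calc _ ≤ ((2 * l + 1) / n) * ∫ x, x i ^ (2 * l) ∂μ := by
          rw [div_mul_eq_mul_div, le_div_iff₀ hn']; linarith
      _ ≤ ((2 * k - 1) / n) * ((2 * k - 1) / n : ℝ) ^ l := by
          gcongr
          · apply div_nonneg <;> linarith
          · linarith
      _ = _ := mul_comm _ _

lemma core {n : ℕ} (hn : 0 < n) (μ : Measure (Fin n → ℝ)) [IsProbabilityMeasure μ]
    (hsphere : ∀ᵐ x ∂μ, ∑ i, (x i) ^ 2 = 1)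
    (hrot : ∀ O ∈ Matrix.orthogonalGroup (Fin n) ℝ,
      Measure.map (fun x => Matrix.mulVec O x) μ = μ) (k : ℕ) (hk : 2 ≤ k) (q c : ℝ) (hc : 0 ≤ c)
    (h : ∀ x : Fin n → ℝ, lpnorm q x ≤ c * (∑ i, |x i| ^ (2 * k : ℝ)) ^ (1 / (2 * k) : ℝ)) :
    (∫ x, (lpnorm q x) ^ 4 ∂μ) ^ ((1 : ℝ) / 2) ≤
      c ^ 2 * ((n : ℝ) ^ (1 / k : ℝ) * ((2 * k - 1) / n)) := by
  have hn' : (0:ℝ) < n := by exact_mod_cast hn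
  have hk' : (2:ℝ) ≤ k := by exact_mod_cast hk
  have hr : (0:ℝ) < (2 * k - 1) / n := by apply div_pos <;> linarith
  set A : ℝ := n * ((2 * k - 1) / n) ^ k with hA
  have hApos : 0 < A := by positivity
  have hSS : ∀ x : Fin n → ℝ, ∑ i, |x i| ^ (2 * k : ℝ) = ∑ i, x i ^ (2 * k) := by
    intro x
    refine Finset.sum_congr rfl fun i _ => ?_
    rw [show (2 * k : ℝ) = ((2 * k : ℕ) : ℝ) by push_cast; rfl, Real.rpow_natCast,
      Even.pow_abs ⟨k, by ring⟩]
  have hS0 : ∀ x : Fin n → ℝ, 0 ≤ ∑ i, x i ^ (2 * k) := fun x =>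
    Finset.sum_nonneg fun i _ => Even.pow_nonneg ⟨k, by ring⟩ _
  have hl0 : ∀ x : Fin n → ℝ, 0 ≤ lpnorm q x := fun x => by unfold lpnorm; positivity
  have hint : Integrable (fun x : Fin n → ℝ => ∑ i, x i ^ (2 * k)) μ := by
    refine integrable_finsetSum _ fun i _ => ?_
    simpa using integ μ hsphere i i (2*k) 0
  have hES : ∫ x, ∑ i, x i ^ (2 * k) ∂μ ≤ A := by
    rw [integral_finsetSum _ (fun i _ => by simpa using integ μ hsphere i i (2*k) 0)]
    calc _ ≤ ∑ i : Fin n, ((2 * k - 1) / n : ℝ) ^ k :=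
          Finset.sum_le_sum fun i _ => moment hn μ hsphere hrot i k k le_rfl
      _ = A := by simp [hA]
  have hpt : ∀ x : Fin n → ℝ, lpnorm q x ^ 4 ≤
      c ^ 4 * (A ^ (2 / k : ℝ) * (1 + (2 / k) * ((∑ i, x i ^ (2 * k)) / A - 1))) := by
    intro x
    have h1 : lpnorm q x ^ 4 ≤ c ^ 4 * (∑ i, x i ^ (2 * k)) ^ (2 / k : ℝ) := by
      calc _ ≤ (c * (∑ i, |x i| ^ (2 * k : ℝ)) ^ (1 / (2 * k) : ℝ)) ^ 4 :=
            pow_le_pow_left₀ (hl0 x) (h x) 4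
        _ = _ := by
          rw [hSS, mul_pow, ← Real.rpow_mul_natCast (hS0 x)]
          congr 2
          push_cast; field_simp; norm_num
    refine h1.trans ?_
    gcongr
    have h2 : ∑ i, x i ^ (2 * k) = A * (1 + ((∑ i, x i ^ (2 * k)) / A - 1)) := by
      field_simp; ring
    have h3 : 0 ≤ (∑ i, x i ^ (2 * k)) / A := div_nonneg (hS0 x) hApos.le
    conv_lhs => rw [h2]
    rw [Real.mul_rpow hApos.le (by linarith)]
    gcongr
    exact rpow_one_add_le_one_add_mul_self (by linarith) (by positivity)
      (by rw [div_le_one] <;> linarith)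
  have hI : ∫ x, (lpnorm q x) ^ 4 ∂μ ≤ c ^ 4 * A ^ (2 / k : ℝ) := by
    calc _ ≤ ∫ x, c ^ 4 * (A ^ (2 / k : ℝ) * (1 + (2 / k) * ((∑ i, x i ^ (2 * k)) / A - 1))) ∂μ := by
          refine integral_mono_of_nonneg (Filter.Eventually.of_forall fun x => pow_nonneg (hl0 x) _)
            ?_ (Filter.Eventually.of_forall hpt)
          have j1 : Integrable (fun x : Fin n → ℝ => (∑ i, x i ^ (2 * k)) / A - 1) μ :=
            (hint.div_const A).sub (integrable_const 1)
          exact (((integrable_const 1).add (j1.const_mul _)).const_mul _).const_mul _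
      _ = c ^ 4 * (A ^ (2 / k : ℝ) * (1 + (2 / k) * ((∫ x, ∑ i, x i ^ (2 * k) ∂μ) / A - 1))) := by
          have j1 : Integrable (fun x : Fin n → ℝ => (∑ i, x i ^ (2 * k)) / A - 1) μ :=
            (hint.div_const A).sub (integrable_const 1)
          rw [integral_const_mul, integral_const_mul, integral_add (integrable_const 1)
            (j1.const_mul _), integral_const_mul,
            integral_sub (hint.div_const A) (integrable_const 1), integral_div]
          simp
      _ ≤ c ^ 4 * (A ^ (2 / k : ℝ) * 1) := by
          have : (∫ x, ∑ i, x i ^ (2 * k) ∂μ) / A ≤ 1 := (div_le_one hApos).2 hES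
          gcongr
          have : (2 / k : ℝ) * ((∫ x, ∑ i, x i ^ (2 * k) ∂μ) / A - 1) ≤ 0 :=
            mul_nonpos_of_nonneg_of_nonpos (by positivity) (by linarith)
          linarith
      _ = _ := by ring
  have hAp : A ^ (2 / k : ℝ) = ((n : ℝ) ^ (1 / k : ℝ) * ((2 * k - 1) / n)) ^ 2 := by
    rw [hA, Real.mul_rpow hn'.le (by positivity), ← Real.rpow_natCast _ k, ← Real.rpow_mul hr.le,
      mul_pow, ← Real.rpow_mul_natCast hn'.le, ← Real.rpow_natCast _ 2]
    congr 2
    · push_cast; ring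
    · push_cast; field_simp
  rw [hAp] at hI
  rw [← Real.sqrt_eq_rpow]
  apply Real.sqrt_le_iff.2 ⟨by positivity, hI.trans_eq (by ring)⟩

lemma lp_le_up {n : ℕ} (hn : 0 < n) (x : Fin n → ℝ) (q p : ℝ) (hq : 0 < q) (hp : q ≤ p) :
    lpnorm q x ≤ (n:ℝ) ^ (1/q - 1/p) * (∑ i, |x i| ^ p) ^ (1/p) := by
  have hn' : (0:ℝ) < n := by exact_mod_cast hn
  have hp0 : 0 < p := hq.trans_le hp
  have h1 := Real.rpow_sum_le_const_mul_sum_rpow Finset.univ (fun i => |x i| ^ q)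
    (p := p / q) (by rwa [le_div_iff₀ hq, one_mul])
  have e : ∀ i, |(|x i| ^ q)| = |x i| ^ q := fun i => abs_of_nonneg (by positivity)
  have e2 : ∀ i, (|x i| ^ q) ^ (p/q) = |x i| ^ p := fun i => by
    rw [← Real.rpow_mul (abs_nonneg _)]; congr 1; field_simp
  simp only [e, e2, Finset.card_univ, Fintype.card_fin] at h1
  have hS : 0 ≤ ∑ i, |x i| ^ q := Finset.sum_nonneg fun i _ => by positivity
  have hT : 0 ≤ ∑ i, |x i| ^ p := Finset.sum_nonneg fun i _ => by positivity
  have h2 := Real.rpow_le_rpow (by positivity) h1 (by positivity : 0 ≤ 1/p)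
  rw [← Real.rpow_mul hS, Real.mul_rpow (by positivity) hT, ← Real.rpow_mul hn'.le] at h2
  unfold lpnorm
  convert h2 using 2
  · field_simp
  · congr 1; field_simp

lemma lp_le_down {n : ℕ} (x : Fin n → ℝ) (q p : ℝ) (hp : 0 < p) (hq : p ≤ q) :
    lpnorm q x ≤ 1 * (∑ i, |x i| ^ p) ^ (1/p) := by
  have hq0 : 0 < q := hp.trans_le hq
  set S := ∑ i, |x i| ^ p with hSd
  have hS : 0 ≤ S := Finset.sum_nonneg fun i _ => by positivity
  have h1 : ∀ i, |x i| ^ q ≤ |x i| ^ p * S ^ ((q-p)/p) := by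
    intro i
    have h : |x i| ^ p ≤ S := Finset.single_le_sum (f := fun i => |x i| ^ p)
      (fun _ _ => by positivity) (Finset.mem_univ i)
    have h2 := Real.rpow_le_rpow (by positivity) h (div_nonneg (by linarith) hp.le : 0 ≤ (q-p)/p)
    calc |x i| ^ q = |x i| ^ p * (|x i| ^ p) ^ ((q-p)/p) := by
          rw [← Real.rpow_mul (abs_nonneg _), mul_div_cancel₀ _ hp.ne',
            ← Real.rpow_add_of_nonneg (abs_nonneg _) hp.le (by linarith)]
          congr 1; ring
      _ ≤ _ := by gcongr
  have h2 : ∑ i, |x i| ^ q ≤ S ^ (q / p) := by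
    calc _ ≤ ∑ i, |x i| ^ p * S ^ ((q-p)/p) := Finset.sum_le_sum fun i _ => h1 i
      _ = S ^ (1:ℝ) * S ^ ((q-p)/p) := by rw [← Finset.sum_mul, Real.rpow_one]
      _ = _ := by
        rw [← Real.rpow_add_of_nonneg hS zero_le_one (div_nonneg (by linarith) hp.le)]
        congr 1; field_simp; ring
  unfold lpnorm
  have h3 := Real.rpow_le_rpow (Finset.sum_nonneg fun i _ => by positivity) h2
    (by positivity : 0 ≤ 1/q)
  rw [← Real.rpow_mul hS] at h3
  rw [one_mul]
  convert h3 using 2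
  field_simp

theorem statement0 (n : ℕ) (hn : 3 ≤ n) (q : ℝ) (hq : 2 ≤ q)
    (μ : Measure (Fin n → ℝ)) [IsProbabilityMeasure μ]
    (hsphere : ∀ᵐ x ∂μ, ∑ i, (x i) ^ 2 = 1)
    (hrot : ∀ O ∈ Matrix.orthogonalGroup (Fin n) ℝ,
      Measure.map (fun x => Matrix.mulVec O x) μ = μ) :
    (∫ x, (lpnorm q x) ^ 4 ∂μ) ^ ((1 : ℝ) / 2) ≤
      min (2 * q - 1) (32 * Real.log n - 8) * (n : ℝ) ^ (2 / q - 1) := by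
  have hn0 : 0 < n := by omega
  have hn' : (0:ℝ) < n := by exact_mod_cast hn0
  have hn3 : (3:ℝ) ≤ n := by exact_mod_cast hn
  have hlog : 1 < Real.log n := by
    rw [Real.lt_log_iff_exp_lt hn']
    linarith [Real.exp_one_lt_d9]
  have hP : (∫ x, (lpnorm q x) ^ 4 ∂μ) ^ ((1 : ℝ) / 2) ≤ (2 * q - 1) * (n : ℝ) ^ (2 / q - 1) := by
    set k := ⌊q⌋₊ with hkd
    have hk : 2 ≤ k := Nat.le_floor (by exact_mod_cast hq)
    have hkq : (k:ℝ) ≤ q := Nat.floor_le (by linarith)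
    have hkq2 : q < k + 1 := Nat.lt_floor_add_one q
    have hk' : (2:ℝ) ≤ k := by exact_mod_cast hk
    have := core hn0 μ hsphere hrot k hk q _ (by positivity)
      (fun x => lp_le_up hn0 x q (2 * k) (by linarith) (by linarith))
    refine this.trans ?_
    have e : ((n:ℝ) ^ (1/q - 1/(2*k) : ℝ)) ^ 2 * ((n : ℝ) ^ (1 / k : ℝ) * ((2 * k - 1) / n)) =
        (2 * k - 1) * (n : ℝ) ^ (2 / q - 1) := by
      rw [← Real.rpow_mul_natCast hn'.le, Real.rpow_sub_one hn'.ne', ← mul_assoc,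
        ← Real.rpow_add hn']
      rw [show (1 / q - 1 / (2 * (k:ℝ))) * (2:ℕ) + 1 / k = 2 / q by push_cast; field_simp; ring]
      ring
    rw [e]
    gcongr
  rcases le_or_gt (2 * q - 1) (32 * Real.log n - 8) with hc | hc
  · rwa [min_eq_left hc]
  · rw [min_eq_right hc.le]
    set k := ⌈Real.log n⌉₊ with hkd
    have hk : 2 ≤ k := by
      have : 1 < k := Nat.lt_ceil.2 (by exact_mod_cast hlog)
      omega
    have hk1 : Real.log n ≤ k := Nat.le_ceil _
    have hk2 : (k:ℝ) < Real.log n + 1 := Nat.ceil_lt_add_one (by linarith)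
    have := core hn0 μ hsphere hrot k hk q _ zero_le_one
      (fun x => lp_le_down x q (2 * k) (by linarith) (by linarith))
    refine this.trans ?_
    have h1 : (n : ℝ) ^ (1 / k : ℝ) ≤ 2.72 := by
      rw [Real.rpow_def_of_pos hn']
      have : Real.log n * (1 / k) ≤ 1 := by
        rw [mul_one_div, div_le_one (by linarith)]; exact hk1
      linarith [Real.exp_le_exp.2 this, Real.exp_one_lt_d9]
    have h2 : 1 ≤ (n:ℝ) ^ (2 / q) := Real.one_le_rpow (by linarith) (by positivity)
    rw [Real.rpow_sub_one hn'.ne', one_pow, one_mul, ← mul_div_assoc, ← mul_div_assoc]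
    refine div_le_div_of_nonneg_right ?_ hn'.le
    have hk' : (2:ℝ) ≤ k := by exact_mod_cast hk
    calc _ ≤ 2.72 * (2 * (k:ℝ) - 1) := by gcongr; linarith
      _ ≤ (32 * Real.log n - 8) * 1 := by linarith
      _ ≤ _ := by gcongr; linarith
end

section
/- Fix integers n ≥ 3 and a decomposition n = n_x + n_y, a real q ∈ [2, ∞), a point z ∈ ℝ^n, τ > 0, and Δ ≥ 0. On a probability space, let e be uniformly distributed on the Euclidean unit sphere S^{n-1} ⊂ ℝ^n and let ξ be a random element of a measurable space Ξ, with e and ξ independent. Let f : ℝ^n × Ξ → ℝ be measurable such that for each ξ the map z ↦ f(z, ξ) is M(ξ)-Lipschitz with respect to ‖·‖₂, where M : Ξ → [0, ∞) satisfies E[M(ξ)²] = M² < ∞. Let δ : ℝ^n → ℝ be measurable with |δ(z)| ≤ Δ for all z. Write ẽ ∈ ℝ^n for the vector obtained from e by negating its last n_y coordinates, and define the random vector g = (n/(2τ))·(f(z + τe, ξ) + δ(z + τe) − f(z − τe, ξ) − δ(z − τe))·ẽ. Then E[‖g‖_q²] ≤ 2·(c·n·M² + n²Δ²/τ²)·a_q²,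 where c = 3 and a_q² = min{2q − 1, 32·log n − 8} · n^{2/q − 1}. -/
open MeasureTheory ProbabilityTheory

/-- The Euclidean (`ℓ₂`) norm of a vector in `ℝ^n`. -/
noncomputable def l2norm {n : ℕ} (x : Fin n → ℝ) : ℝ :=
  Real.sqrt (∑ i, (x i) ^ 2)


section PartA
open scoped Nat
theorem gmom (k : ℕ) : ∫ x, x^(2*k) ∂(gaussianReal 0 1) = ((2*k-1 : ℕ)‼ : ℝ) := by
  rw [integral_gaussianReal_eq_integral_smul (by norm_num)]
  have h1 : ∀ x : ℝ, gaussianPDFReal 0 1 x • x^(2*k) = (fun y : ℝ => (√(2*Real.pi))⁻¹ * (y^((2*k : ℕ):ℝ) * Real.exp (-(1/2) * y^(2:ℝ)))) |x| := by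
    intro x
    simp only [gaussianPDFReal, Real.rpow_natCast, smul_eq_mul]
    rw [show (2:ℝ) = ((2:ℕ):ℝ) by norm_num, Real.rpow_natCast, sq_abs, pow_mul |x|, sq_abs]
    simp
    ring_nf
  simp_rw [h1]
  rw [integral_comp_abs (f := fun y : ℝ => (√(2*Real.pi))⁻¹ * (y^((2*k : ℕ):ℝ) * Real.exp (-(1/2) * y^(2:ℝ)))), integral_const_mul,
    integral_rpow_mul_exp_neg_mul_rpow (by norm_num) (by have : (0:ℝ) ≤ ((2*k:ℕ):ℝ) := by positivity
                                                         linarith) (by norm_num)]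
  have : (((2*k:ℕ):ℝ)+1)/2 = k + 1/2 := by push_cast; ring
  rw [this, Real.Gamma_nat_add_half, show (-(((2*k:ℕ):ℝ)+1)/2) = -(k + 1/2) by push_cast; ring]
  have h2 : (1/2:ℝ)^(-((k:ℝ)+1/2)) = 2^k * √2 := by
    rw [one_div, Real.inv_rpow (by norm_num), Real.rpow_neg (by norm_num), inv_inv, Real.rpow_add (by norm_num), Real.rpow_natCast, Real.sqrt_eq_rpow]
    norm_num
  rw [h2, Real.sqrt_mul (by norm_num)]
  have := Real.sqrt_pos.2 Real.pi_pos
  have h3 : (0:ℝ) < √2 := by positivity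
  field_simp

theorem dfle (k : ℕ) : (2*k-1 : ℕ)‼ ≤ k^k := by
  induction k with
  | zero => simp
  | succ k ih =>
    rcases Nat.eq_zero_or_pos k with rfl | hk
    · simp
    have e1 : 2*(k+1)-1 = (2*k-1)+2 := by omega
    rw [e1, Nat.doubleFactorial_add_two]
    have h2 : 2 * k^k ≤ (k+1)^k := by
      have := one_add_mul_le_pow (a := (1/(k:ℝ))) (by have : (0:ℝ) ≤ 1/(k:ℝ) := by positivity
                                                      linarith) k
      have hk' : (0:ℝ) < k := by exact_mod_cast hk
      have e : (1 + 1/(k:ℝ))^k = (k+1)^k / k^k := by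
        rw [← div_pow]; congr 1; field_simp
      rw [e, le_div_iff₀ (by positivity)] at this
      have : (2:ℝ) * k^k ≤ (k+1)^k := by
        have e0 : 1 + (k:ℝ) * (1/k) = 2 := by field_simp; norm_num
        rwa [e0] at this
      exact_mod_cast this
    calc (2*k-1+2) * (2*k-1)‼ ≤ (2*(k+1)) * k^k := by gcongr; omega
      _ = (k+1) * (2*k^k) := by ring
      _ ≤ (k+1) * (k+1)^k := by gcongr
      _ = _ := by ring

theorem gauss_ac {E : Type*} [NormedAddCommGroup E] [InnerProductSpace ℝ E] [FiniteDimensional ℝ E]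
  [MeasurableSpace E] [BorelSpace E] : stdGaussian E ≪ (volume : Measure E) := by
  set c : ℝ := (∫ v : E, Real.exp (-(1/2) * ‖v‖^2))⁻¹ with hc
  have hI := GaussianFourier.integral_rexp_neg_mul_sq_norm (V := E) (b := 1/2) (by norm_num)
  have hcpos : 0 < c := by rw [hc, hI]; positivity
  have hint : Integrable (fun v : E => Real.exp (-(1/2) * ‖v‖^2)) := by
    by_contra h
    rw [hc, integral_undef h] at hcpos; simp at hcpos
  set d : E → NNReal := fun v => (c * Real.exp (-(1/2) * ‖v‖^2)).toNNReal with hd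
  have hdm : Measurable d := by fun_prop
  have hfin : IsFiniteMeasure ((volume : Measure E).withDensity (fun v => (d v : ENNReal))) := by
    apply isFiniteMeasure_withDensity_ofReal (f := fun v : E => c * Real.exp (-(1/2) * ‖v‖^2))
    exact (hint.const_mul c).2
  have : stdGaussian E = (volume : Measure E).withDensity (fun v => (d v : ENNReal)) := by
    apply Measure.ext_of_charFun
    ext t
    rw [charFun_stdGaussian, charFun_apply, integral_withDensity_eq_integral_smul hdm]
    have h0 := GaussianFourier.integral_cexp_neg_mul_sq_norm_add (V := E) (b := 1/2) (by norm_num) 0 0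
    have h1 := GaussianFourier.integral_cexp_neg_mul_sq_norm_add (V := E) (b := 1/2) (by norm_num) Complex.I t
    have e1 : ∀ v : E, d v • Complex.exp (inner ℝ v t * Complex.I) = (c:ℂ) * Complex.exp (-(1/2) * ‖v‖^2 + Complex.I * inner ℝ t v) := by
      intro v
      rw [NNReal.smul_def, hd, Real.coe_toNNReal _ (by positivity), Complex.exp_add, real_inner_comm v t]
      simp
      ring_nf
    simp_rw [e1]
    rw [integral_const_mul, h1]
    have e2 : ((∫ v : E, Real.exp (-(1/2) * ‖v‖^2) : ℝ) : ℂ) = (Real.pi / (1/2) : ℂ)^(Module.finrank ℝ E / 2 : ℂ) := by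
      rw [← integral_complex_ofReal]
      simpa using h0
    have e3 : (c:ℂ) * (Real.pi / (1/2) : ℂ)^(Module.finrank ℝ E / 2 : ℂ) = 1 := by
      rw [← e2, ← Complex.ofReal_mul, hc, inv_mul_cancel₀]; simp
      intro h; rw [hc, h] at hcpos; simp at hcpos
    rw [← mul_assoc, e3, Complex.I_sq]
    ring_nf
  rw [this]
  exact withDensity_absolutelyContinuous _ _

end PartA

section PartB
open scoped Nat

theorem lint4 {α : Type*} [MeasurableSpace α] (ν : Measure α) (f : α → ENNReal) (hf : AEMeasurable f ν) :
    (∫⁻ a, f a ∂ν)^4 ≤ ν Set.univ ^ 3 * ∫⁻ a, f a ^ 4 ∂ν := by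
  have hpq : (4:ℝ).HolderConjugate (4/3) := by
    rw [Real.holderConjugate_iff]; norm_num
  have h := ENNReal.lintegral_mul_le_Lp_mul_Lq ν hpq hf (aemeasurable_const (b := (1:ENNReal)))
  simp only [Pi.mul_apply, mul_one, ENNReal.one_rpow, lintegral_one] at h
  calc (∫⁻ a, f a ∂ν)^4 ≤ ((∫⁻ (a : α), f a ^ (4:ℝ) ∂ν) ^ ((1:ℝ) / 4) * (ν Set.univ) ^ ((1:ℝ) / (4 / 3)))^4 := by
        gcongr
    _ = _ := by
        rw [mul_pow, ← ENNReal.rpow_natCast, ← ENNReal.rpow_natCast, ← ENNReal.rpow_mul, ← ENNReal.rpow_mul, mul_comm]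
        congr 1
        · norm_num
        · norm_num

theorem enorm_pow_even (x : ℝ) (k : ℕ) : ‖x‖ₑ^(2*k) = ENNReal.ofReal (x^(2*k)) := by
  rw [← enorm_pow, Real.enorm_eq_ofReal]
  rw [pow_mul]; positivity

theorem gint (k : ℕ) : Integrable (fun x : ℝ => x^(2*k)) (gaussianReal 0 1) := by
  by_contra h
  have := gmom k
  rw [integral_undef h] at this
  have h2 := Nat.doubleFactorial_pos (2*k-1)
  have : ((2*k-1 : ℕ)‼ : ℝ) ≠ 0 := by positivity
  simp_all

theorem gmomL (k : ℕ) : ∫⁻ x, ‖x‖ₑ^(2*k) ∂(gaussianReal 0 1) = ((2*k-1 : ℕ)‼ : ENNReal) := by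
  simp_rw [enorm_pow_even]
  rw [← ofReal_integral_eq_lintegral_ofReal (gint k), gmom]
  · simp
  · exact Filter.Eventually.of_forall (fun x => by simp only [Pi.zero_apply]; rw [pow_mul]; positivity)

section
variable {E : Type*} [NormedAddCommGroup E] [InnerProductSpace ℝ E] [FiniteDimensional ℝ E]
  [MeasurableSpace E] [BorelSpace E]

theorem dual_mom (D : StrongDual ℝ E) (k : ℕ) : ∫⁻ y, ‖D y‖ₑ^(2*k) ∂(stdGaussian E) = ‖D‖ₑ^(2*k) * ((2*k-1 : ℕ)‼ : ENNReal) := by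
  have h1 := IsGaussian.map_eq_gaussianReal (μ := stdGaussian E) D
  rw [integral_strongDual_stdGaussian, variance_dual_stdGaussian] at h1
  have h2 := gaussianReal_map_const_mul (μ := 0) (v := 1) ‖D‖
  have h3 : Measure.map D (stdGaussian E) = Measure.map (fun x => ‖D‖ * x) (gaussianReal 0 1) := by
    rw [h1, h2]
    congr 1
    · simp
    · ext; simp
  have h4 : ∫⁻ y, ‖D y‖ₑ^(2*k) ∂(stdGaussian E) = ∫⁻ z, ‖z‖ₑ^(2*k) ∂(Measure.map D (stdGaussian E)) := by
    rw [lintegral_map (by fun_prop) (by fun_prop)]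
  rw [h4, h3, lintegral_map (by fun_prop) (by fun_prop)]
  simp_rw [enorm_mul, mul_pow]
  rw [lintegral_const_mul _ (by fun_prop), gmomL]
  simp

theorem maurey_pisier (H : E → ℝ) (K : NNReal) (hH : LipschitzWith K H) :
    ∫⁻ p, ‖H p.2 - H p.1‖ₑ^4 ∂((stdGaussian E).prod (stdGaussian E)) ≤
      ENNReal.ofReal (Real.pi/2)^4 * ((K:ENNReal)^4 * 3) := by
  set μ := stdGaussian E with hμ
  set lam := (volume : Measure ℝ).restrict (Set.Ioc 0 (Real.pi/2)) with hlam
  have hlu : lam Set.univ = ENNReal.ofReal (Real.pi/2) := by simp [hlam]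
  let R : ℝ → E × E → E × E := fun θ p => (Real.cos θ • p.1 + Real.sin θ • p.2, -Real.sin θ • p.1 + Real.cos θ • p.2)
  have hRc : Continuous (fun x : (E × E) × ℝ => R x.2 x.1) := by fun_prop
  have hRm : ∀ θ, MeasurePreserving (R θ) (μ.prod μ) (μ.prod μ) := by
    intro θ
    refine ⟨by fun_prop, ?_⟩
    exact IsGaussian.map_rotation_eq_self (μ := μ) (by simp [hμ]) θ
  have hdm : MeasurableSet {x | DifferentiableAt ℝ H x} := measurableSet_of_differentiableAt ℝ H
  have hdae : ∀ᵐ x ∂μ, DifferentiableAt ℝ H x :=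
    gauss_ac.ae_le (hH.ae_differentiableAt (μ := volume))
  have hdae2 : ∀ᵐ p ∂(μ.prod μ), DifferentiableAt ℝ H p.1 :=
    Measure.quasiMeasurePreserving_fst.ae hdae
  have hae : ∀ᵐ p ∂(μ.prod μ), ∀ᵐ θ ∂lam, DifferentiableAt ℝ H (R θ p).1 := by
    rw [Measure.ae_ae_comm]
    · exact Filter.Eventually.of_forall (fun θ => (hRm θ).quasiMeasurePreserving.ae hdae2)
    · exact (hRc.fst.measurable) hdm
  let G : E × E → ENNReal := fun p => ‖fderiv ℝ H p.1 p.2‖ₑ^4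
  have hGm : Measurable G := by
    have h1 : Measurable (fun p : E × E => fderiv ℝ H p.1) := (measurable_fderiv ℝ H).comp measurable_fst
    have : Measurable (fun p : E × E => fderiv ℝ H p.1 p.2) := by
      have hb : Continuous (fun x : (E →L[ℝ] ℝ) × E => x.1 x.2) := by fun_prop
      exact hb.measurable.comp (h1.prodMk measurable_snd)
    fun_prop
  have key : ∀ᵐ p ∂(μ.prod μ), ‖H p.2 - H p.1‖ₑ^4 ≤ ENNReal.ofReal (Real.pi/2)^3 * ∫⁻ θ, G (R θ p) ∂lam := by
    filter_upwards [hae] with p hp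
    let ph : ℝ → ℝ := fun θ => H (R θ p).1
    have hder : ∀ᵐ θ ∂lam, deriv ph θ = fderiv ℝ H (R θ p).1 (R θ p).2 := by
      filter_upwards [hp] with θ hθ
      have h1 : HasDerivAt (fun θ => (R θ p).1) (R θ p).2 θ := by
        exact ((Real.hasDerivAt_cos θ).smul_const p.1).add ((Real.hasDerivAt_sin θ).smul_const p.2)
      exact (hθ.hasFDerivAt.comp_hasDerivAt θ h1).deriv
    have hLip : LipschitzWith (K * (‖p.1‖₊ + ‖p.2‖₊)) ph := by
      apply hH.comp
      apply LipschitzWith.add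
      · apply LipschitzWith.of_dist_le_mul
        intro x y
        rw [dist_eq_norm, ← sub_smul, norm_smul, mul_comm, coe_nnnorm]
        gcongr
        have := Real.lipschitzWith_cos.dist_le_mul x y
        simpa [Real.dist_eq] using this
      · apply LipschitzWith.of_dist_le_mul
        intro x y
        rw [dist_eq_norm, ← sub_smul, norm_smul, mul_comm, coe_nnnorm]
        gcongr
        have := Real.lipschitzWith_sin.dist_le_mul x y
        simpa [Real.dist_eq] using this
    have hftc := (hLip.lipschitzOnWith (s := Set.uIcc 0 (Real.pi/2))).absolutelyContinuousOnInterval.integral_deriv_eq_sub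
    have e1 : ph (Real.pi/2) = H p.2 := by simp [ph, R]
    have e0 : ph 0 = H p.1 := by simp [ph, R]
    rw [e1, e0, intervalIntegral.integral_of_le (by positivity)] at hftc
    rw [← hftc]
    calc _ ≤ (∫⁻ θ, ‖deriv ph θ‖ₑ ∂lam)^4 := by gcongr; exact enorm_integral_le_lintegral_enorm _
      _ ≤ lam Set.univ ^ 3 * ∫⁻ θ, ‖deriv ph θ‖ₑ^4 ∂lam := lint4 _ _ (measurable_deriv ph).enorm.aemeasurable
      _ = _ := by
        rw [hlu]; congr 1
        apply lintegral_congr_ae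
        filter_upwards [hder] with θ hθ
        rw [hθ]
  have hG : ∫⁻ p, G p ∂(μ.prod μ) ≤ (K:ENNReal)^4 * 3 := by
    rw [lintegral_prod _ hGm.aemeasurable]
    calc _ ≤ ∫⁻ x, (K:ENNReal)^4 * 3 ∂μ := by
          apply lintegral_mono
          intro x
          have := dual_mom (fderiv ℝ H x) 2
          simp only [G]
          rw [this]
          have h3 : ((2*2-1 : ℕ)‼ : ENNReal) = 3 := by norm_num [Nat.doubleFactorial]
          rw [h3]
          gcongr
          have := norm_fderiv_le_of_lipschitz ℝ hH (x₀ := x)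
          rw [enorm_eq_nnnorm]
          exact_mod_cast this
      _ = _ := by simp
  calc _ ≤ ∫⁻ p, ENNReal.ofReal (Real.pi/2)^3 * ∫⁻ θ, G (R θ p) ∂lam ∂(μ.prod μ) := lintegral_mono_ae key
    _ = ENNReal.ofReal (Real.pi/2)^3 * ∫⁻ p, ∫⁻ θ, G (R θ p) ∂lam ∂(μ.prod μ) := by
        rw [lintegral_const_mul']
        simp
    _ = ENNReal.ofReal (Real.pi/2)^3 * ∫⁻ θ, ∫⁻ p, G (R θ p) ∂(μ.prod μ) ∂lam := by
        rw [lintegral_lintegral_swap]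
        exact (hGm.comp hRc.measurable).aemeasurable
    _ = ENNReal.ofReal (Real.pi/2)^3 * ∫⁻ θ, ∫⁻ p, G p ∂(μ.prod μ) ∂lam := by
        congr 2; ext θ
        exact (hRm θ).lintegral_comp hGm
    _ = ENNReal.ofReal (Real.pi/2)^4 * ∫⁻ p, G p ∂(μ.prod μ) := by
        rw [lintegral_const, hlu]; ring
    _ ≤ _ := by gcongr

theorem odd_mom (H : E → ℝ) (K : NNReal) (hH : LipschitzWith K H) (hodd : ∀ x, H (-x) = - H x) :
    2 * ∫⁻ x, ‖H x‖ₑ^4 ∂(stdGaussian E) ≤ ENNReal.ofReal (Real.pi/2)^4 * ((K:ENNReal)^4 * 3) := by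
  set μ := stdGaussian E with hμ
  have h1 := maurey_pisier H K hH
  have hHm : Measurable H := hH.continuous.measurable
  have hneg : MeasurePreserving (fun x : E => -x) μ μ := by
    refine ⟨by fun_prop, ?_⟩
    exact stdGaussian_map (LinearIsometryEquiv.neg ℝ : E ≃ₗᵢ[ℝ] E)
  have hneg2 : MeasurePreserving (Prod.map id (fun x : E => -x)) (μ.prod μ) (μ.prod μ) :=
    (MeasurePreserving.id μ).prod hneg
  have h2 : ∫⁻ p, ‖H p.2 + H p.1‖ₑ^4 ∂(μ.prod μ) = ∫⁻ p, ‖H p.2 - H p.1‖ₑ^4 ∂(μ.prod μ) := by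
    rw [← hneg2.lintegral_comp (f := fun p => ‖H p.2 - H p.1‖ₑ^4) (by fun_prop)]
    congr 1; ext p
    simp only [Prod.map_fst, Prod.map_snd, id, hodd]
    rw [← enorm_neg]; congr 2; ring
  have h3 : ∫⁻ p, (2 * ‖H p.1‖ₑ^4 + 2 * ‖H p.2‖ₑ^4) ∂(μ.prod μ) ≤ ∫⁻ p, (‖H p.2 - H p.1‖ₑ^4 + ‖H p.2 + H p.1‖ₑ^4) ∂(μ.prod μ) := by
    apply lintegral_mono
    intro p
    have e : ∀ x : ℝ, ‖x‖ₑ^4 = ENNReal.ofReal (x^4) := fun x => enorm_pow_even x 2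
    simp only [e]
    rw [show (2:ENNReal) = ENNReal.ofReal 2 by norm_num, ← ENNReal.ofReal_mul (by norm_num), ← ENNReal.ofReal_mul (by norm_num),
      ← ENNReal.ofReal_add (by positivity) (by positivity), ← ENNReal.ofReal_add (by positivity) (by positivity)]
    apply ENNReal.ofReal_le_ofReal
    nlinarith [sq_nonneg (H p.1 * H p.2)]
  rw [lintegral_add_left (by fun_prop), lintegral_add_left (by fun_prop), h2,
    lintegral_const_mul _ (by fun_prop), lintegral_const_mul _ (by fun_prop),
    measurePreserving_fst.lintegral_comp (f := fun x => ‖H x‖ₑ^4) (by fun_prop),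
    measurePreserving_snd.lintegral_comp (f := fun x => ‖H x‖ₑ^4) (by fun_prop)] at h3
  rw [← two_mul, ← two_mul] at h3
  have h4 := (ENNReal.mul_le_mul_iff_right (by norm_num) (by norm_num)).1 h3
  exact h4.trans h1
end

end PartB

section PartC
open scoped Nat

section
variable {E : Type*} [NormedAddCommGroup E] [InnerProductSpace ℝ E] [FiniteDimensional ℝ E]
  [MeasurableSpace E] [BorelSpace E]

theorem charFun_rot (ν : Measure E) (hrot : ∀ O : E ≃ₗᵢ[ℝ] E, ν.map O = ν) (u v : E) (h : ‖u‖ = ‖v‖) :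
    charFun ν u = charFun ν v := by
  set O := ((Submodule.span ℝ {u - v})ᗮ).reflection with hO
  have hOu : O u = v := Submodule.reflection_sub h
  rw [charFun_apply, charFun_apply]
  conv_rhs => rw [← hrot O, integral_map (by fun_prop) (by fun_prop)]
  simp_rw [← hOu, LinearIsometryEquiv.inner_map_map]

theorem polar (ν : Measure E) [IsProbabilityMeasure ν] (h1 : ∀ᵐ x ∂ν, ‖x‖ = 1)
    (hrot : ∀ O : E ≃ₗᵢ[ℝ] E, ν.map O = ν) :
    MeasurePreserving (fun p : E × E => ‖p.1‖ • p.2) ((stdGaussian E).prod ν) (stdGaussian E) := by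
  set μ := stdGaussian E with hμ
  refine ⟨by fun_prop, ?_⟩
  have : IsProbabilityMeasure (Measure.map (fun p : E × E => ‖p.1‖ • p.2) (μ.prod ν)) :=
    Measure.isProbabilityMeasure_map (by fun_prop)
  apply Measure.ext_of_charFun
  ext t
  rw [charFun_apply, integral_map (by fun_prop) (by fun_prop)]
  have hint : ∀ T : E × E → ℝ, Continuous T → Integrable (fun p => Complex.exp (T p * Complex.I)) (μ.prod ν) := by
    intro T hT
    apply Integrable.of_bound (C := 1)
    · fun_prop
    · exact Filter.Eventually.of_forall (fun p => by rw [Complex.norm_exp_ofReal_mul_I])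
  rw [integral_prod _ (hint (fun p => inner ℝ (‖p.1‖ • p.2) t) (by fun_prop))]
  have e1 : ∀ x : E, ∫ y, Complex.exp (inner ℝ (‖x‖ • y) t * Complex.I) ∂ν = ∫ y, Complex.exp (inner ℝ x (‖t‖ • y) * Complex.I) ∂ν := by
    intro x
    have := charFun_rot ν hrot (‖x‖ • t) (‖t‖ • x) (by simp [norm_smul, mul_comm])
    rw [charFun_apply, charFun_apply] at this
    convert this using 5
    · rw [real_inner_smul_left, real_inner_smul_right]
    · rw [real_inner_smul_right, real_inner_smul_right, real_inner_comm]
  simp_rw [e1]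
  rw [integral_integral_swap (hint (fun p => inner ℝ p.1 (‖t‖ • p.2)) (by fun_prop))]
  simp_rw [← charFun_apply, hμ, charFun_stdGaussian]
  have : ∀ᵐ y ∂ν, Complex.exp (-(‖‖t‖ • y‖:ℂ)^2/2) = Complex.exp (-(‖t‖:ℂ)^2/2) := by
    filter_upwards [h1] with y hy
    simp [norm_smul, hy]
  rw [integral_congr_ae this]
  simp

theorem norm_sq_mom : ∫⁻ x, ‖x‖ₑ^2 ∂(stdGaussian E) = (Module.finrank ℝ E : ENNReal) := by
  set b := stdOrthonormalBasis ℝ E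
  have e : ∀ x : E, ‖x‖ₑ^2 = ∑ i, ‖innerSL ℝ (b i) x‖ₑ^(2*1) := by
    intro x
    simp_rw [enorm_pow_even]
    rw [← ENNReal.ofReal_sum_of_nonneg (fun i _ => by rw [pow_mul]; positivity), ← ofReal_norm, ← ENNReal.ofReal_pow (by positivity)]
    congr 1
    rw [← b.sum_sq_inner_right x]; simp
  simp_rw [e]
  rw [lintegral_finsetSum _ (by fun_prop)]
  simp_rw [dual_mom]
  have : ∀ i, ‖innerSL ℝ (b i)‖ₑ = 1 := by
    intro i
    rw [← ofReal_norm, innerSL_apply_norm]; simp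
  simp [this]

theorem tangent (s : ENNReal) (m : ℕ) (k : ℕ) :
    ((k:ENNReal)+1) * m^k * s ≤ s^(k+1) + k * m^(k+1) := by
  induction s using ENNReal.recTopCoe with
  | top => simp
  | coe s =>
    have : ((k:ℝ)+1) * m^k * s ≤ (s:ℝ)^(k+1) + k * m^(k+1) := by
      rcases Nat.eq_zero_or_pos m with rfl | hm
      · rcases Nat.eq_zero_or_pos k with rfl | hk
        · simp
        · simp [hk.ne']
      have hm' : (0:ℝ) < m := by exact_mod_cast hm
      have h := one_add_mul_le_pow (a := (s:ℝ)/m - 1) (by have : 0 ≤ (s:ℝ)/m := by positivity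
                                                          linarith) (k+1)
      have h2 : (1 + ((s:ℝ)/m - 1))^(k+1) = s^(k+1)/m^(k+1) := by rw [← div_pow]; congr 1; ring
      rw [h2, le_div_iff₀ (by positivity)] at h
      have h3 : (1 + ((k+1:ℕ):ℝ) * ((s:ℝ)/m - 1)) * m^(k+1) = (k+1) * m^k * s - k * m^(k+1) := by
        push_cast; field_simp; ring
      linarith
    exact_mod_cast this

theorem norm_mom (k : ℕ) : (Module.finrank ℝ E : ENNReal)^(k+1) ≤ ∫⁻ x, ‖x‖ₑ^(2*(k+1)) ∂(stdGaussian E) := by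
  set m := Module.finrank ℝ E with hm
  have h : ∫⁻ x, ((k:ENNReal)+1) * m^k * ‖x‖ₑ^2 ∂(stdGaussian E) ≤ ∫⁻ x, ((‖x‖ₑ^2)^(k+1) + k * m^(k+1)) ∂(stdGaussian E) :=
    lintegral_mono (fun x => tangent _ m k)
  rw [lintegral_const_mul _ (by fun_prop), norm_sq_mom, lintegral_add_left (by fun_prop), lintegral_const, measure_univ, mul_one] at h
  simp_rw [← pow_mul] at h
  have e : ((k:ENNReal)+1) * m^k * m = m^(k+1) + k * m^(k+1) := by ring
  rw [← hm, e] at h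
  have hfin : (k:ENNReal) * m^(k+1) ≠ ⊤ := by exact_mod_cast ENNReal.natCast_ne_top (k * m^(k+1))
  exact (ENNReal.add_le_add_iff_right hfin).1 h

theorem sph_mom (ν : Measure E) [IsProbabilityMeasure ν] (h1 : ∀ᵐ x ∂ν, ‖x‖ = 1)
    (hrot : ∀ O : E ≃ₗᵢ[ℝ] E, ν.map O = ν) (u : E) (hu : ‖u‖ = 1) (k : ℕ) :
    (Module.finrank ℝ E : ENNReal)^(k+1) * ∫⁻ x, ‖inner ℝ u x‖ₑ^(2*(k+1)) ∂ν ≤ ((2*(k+1)-1 : ℕ)‼ : ENNReal) := by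
  have hd := dual_mom (innerSL ℝ u) (k+1)
  have hn : ‖innerSL ℝ u‖ₑ = 1 := by rw [← ofReal_norm, innerSL_apply_norm]; simp [hu]
  rw [hn, one_pow, one_mul, ← (polar ν h1 hrot).lintegral_comp (by fun_prop), lintegral_prod _ (by fun_prop)] at hd
  simp only [innerSL_apply_apply, real_inner_smul_right, enorm_mul, mul_pow, enorm_norm] at hd
  rw [← hd, lintegral_lintegral_mul (f := fun x : E => ‖x‖ₑ^(2*(k+1))) (g := fun x : E => ‖inner ℝ u x‖ₑ^(2*(k+1))) (by fun_prop) (by fun_prop)]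
  gcongr
  exact norm_mom k

theorem sph_lip (ν : Measure E) [IsProbabilityMeasure ν] (h1 : ∀ᵐ x ∂ν, ‖x‖ = 1)
    (hrot : ∀ O : E ≃ₗᵢ[ℝ] E, ν.map O = ν) (h : E → ℝ) (K : NNReal) (hh : LipschitzWith K h) :
    (Module.finrank ℝ E : ENNReal)^2 * ∫⁻ x, ‖h x - h (-x)‖ₑ^4 ∂ν ≤ ENNReal.ofReal (585 * (K:ℝ)^4) := by
  set F : E → ℝ := fun x => h x - h (-x) with hF
  have hF1 : ∀ x y, |F x - F y| ≤ 2 * K * ‖x - y‖ := by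
    intro x y
    have a1 := hh.dist_le_mul x y
    have a2 := hh.dist_le_mul (-x) (-y)
    rw [Real.dist_eq, dist_eq_norm] at a1 a2
    have : ‖-x - -y‖ = ‖x - y‖ := by rw [← norm_neg]; congr 1; abel
    rw [this] at a2
    simp only [hF]
    rw [abs_le] at *
    constructor <;> linarith [a1.1, a1.2, a2.1, a2.2]
  have hF2 : ∀ x, |F x| ≤ 2 * K * ‖x‖ := by
    intro x
    have a1 := hh.dist_le_mul x (-x)
    rw [Real.dist_eq, dist_eq_norm] at a1
    have : ‖x - -x‖ = 2 * ‖x‖ := by rw [sub_neg_eq_add, ← two_smul ℝ x, norm_smul]; simp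
    rw [this] at a1
    simp only [hF]; linarith
  have hFodd : ∀ x, F (-x) = - F x := by intro x; simp [hF]
  let H : E → ℝ := fun x => ‖x‖ * F (‖x‖⁻¹ • x)
  have hHodd : ∀ x, H (-x) = - H x := by
    intro x; simp only [H, norm_neg, smul_neg, hFodd]; ring
  have hun : ∀ x : E, ‖‖x‖⁻¹ • x‖ ≤ 1 := by
    intro x
    rw [norm_smul, norm_inv, norm_norm]; exact inv_mul_le_one
  have hre : ∀ x : E, ‖x‖ • (‖x‖⁻¹ • x) = x := by
    intro x
    by_cases hx : x = 0
    · simp [hx]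
    · rw [smul_smul, mul_inv_cancel₀ (by simpa using hx), one_smul]
  have main : ∀ x y, ‖x‖ ≤ ‖y‖ → |H x - H y| ≤ 2 * √2 * K * ‖x - y‖ := by
    intro x y hxy
    set u := ‖x‖⁻¹ • x with hu
    set v := ‖y‖⁻¹ • y with hv
    have hb : |H x - H y| ≤ 2 * K * (‖x‖ * ‖u - v‖ + (‖y‖ - ‖x‖)) := by
      have e : H x - H y = ‖x‖ * (F u - F v) + (‖x‖ - ‖y‖) * F v := by simp only [H]; ring
      rw [e]
      refine (abs_add_le _ _).trans ?_
      rw [abs_mul, abs_mul, abs_norm, abs_of_nonpos (by linarith : ‖x‖ - ‖y‖ ≤ 0)]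
      have b1 := hF1 u v
      have b2 := (hF2 v).trans (mul_le_mul_of_nonneg_left (hun y) (by positivity))
      have b3 := mul_le_mul_of_nonneg_left b1 (norm_nonneg x)
      have b4 := mul_le_mul_of_nonneg_left b2 (by linarith : 0 ≤ -(‖x‖ - ‖y‖))
      nlinarith
    have hc : (‖x‖ * ‖u - v‖)^2 + (‖y‖ - ‖x‖)^2 ≤ ‖x - y‖^2 := by
      by_cases hx : x = 0
      · simp [hx]
      have hx' : 0 < ‖x‖ := norm_pos_iff.2 hx
      have hy' : 0 < ‖y‖ := by linarith
      have nu : ‖u‖ = 1 := by rw [hu, norm_smul, norm_inv, norm_norm, inv_mul_cancel₀ hx'.ne']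
      have nv : ‖v‖ = 1 := by rw [hv, norm_smul, norm_inv, norm_norm, inv_mul_cancel₀ hy'.ne']
      have e1 : ‖x - y‖^2 = ‖x‖^2 - 2 * (‖x‖ * ‖y‖ * inner ℝ u v) + ‖y‖^2 := by
        rw [norm_sub_sq_real]
        conv_lhs => rw [← hre x, ← hre y, real_inner_smul_left, real_inner_smul_right, hre, hre]
        ring
      have e2 : ‖u - v‖^2 = 2 - 2 * inner ℝ u v := by rw [norm_sub_sq_real, nu, nv]; ring
      have e3 : 0 ≤ 2 - 2 * inner ℝ u v := by rw [← e2]; positivity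
      rw [mul_pow, e1, e2]
      nlinarith [mul_nonneg (mul_nonneg hx'.le (sub_nonneg.2 hxy)) e3]
    have hd : ‖x‖ * ‖u - v‖ + (‖y‖ - ‖x‖) ≤ √2 * ‖x - y‖ := by
      apply abs_le_of_sq_le_sq' _ (by positivity) |>.2
      rw [mul_pow, Real.sq_sqrt (by norm_num)]
      nlinarith [sq_nonneg (‖x‖ * ‖u - v‖ - (‖y‖ - ‖x‖))]
    calc _ ≤ _ := hb
      _ ≤ 2 * K * (√2 * ‖x - y‖) := by gcongr
      _ = _ := by ring
  have hHL : LipschitzWith (2 * NNReal.sqrt 2 * K) H := by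
    apply LipschitzWith.of_dist_le_mul
    intro x y
    rw [Real.dist_eq, dist_eq_norm]
    push_cast
    rcases le_total ‖x‖ ‖y‖ with hxy | hxy
    · exact main x y hxy
    · rw [abs_sub_comm, norm_sub_rev]; exact main y x hxy
  have hHm := hHL.continuous.measurable
  have hFm : Measurable F := by
    have := hh.continuous.measurable
    fun_prop
  have ho := odd_mom H _ hHL hHodd
  rw [← (polar ν h1 hrot).lintegral_comp (by fun_prop), lintegral_prod _ (by fun_prop)] at ho
  have e1 : ∀ x : E, ∫⁻ y, ‖H (‖x‖ • y)‖ₑ^4 ∂ν = ∫⁻ y, ‖x‖ₑ^(2*(1+1)) * ‖F y‖ₑ^4 ∂ν := by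
    intro x
    apply lintegral_congr_ae
    filter_upwards [h1] with y hy
    have : H (‖x‖ • y) = ‖x‖ * F y := by
      simp only [H, norm_smul, hy, norm_norm, mul_one, smul_smul]
      by_cases hx : ‖x‖ = 0
      · simp [hx]
      · rw [inv_mul_cancel₀ hx, one_smul]
    rw [this, enorm_mul, mul_pow, enorm_norm]
  simp only [e1] at ho
  rw [lintegral_lintegral_mul (f := fun x : E => ‖x‖ₑ^(2*(1+1))) (g := fun x : E => ‖F x‖ₑ^4) (by fun_prop) (by fun_prop)] at ho
  have h5 : 2 * ((Module.finrank ℝ E : ENNReal)^2 * ∫⁻ x, ‖F x‖ₑ^4 ∂ν) ≤ 2 * ENNReal.ofReal (585 * (K:ℝ)^4) := by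
    calc _ ≤ 2 * ((∫⁻ x, ‖x‖ₑ^(2*(1+1)) ∂(stdGaussian E)) * ∫⁻ x, ‖F x‖ₑ^4 ∂ν) := by
          gcongr; exact norm_mom 1
      _ ≤ _ := ho
      _ ≤ _ := by
        have e2 : ((2 * NNReal.sqrt 2 * K : NNReal) : ENNReal) = ENNReal.ofReal (2 * √2 * K) := by
          rw [ENNReal.ofReal, ENNReal.coe_inj]; ext; simp [Real.coe_toNNReal', mul_nonneg]
        rw [e2, show (3:ENNReal) = ENNReal.ofReal 3 by norm_num, show (2:ENNReal) = ENNReal.ofReal 2 by norm_num,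
          ← ENNReal.ofReal_pow (by positivity), ← ENNReal.ofReal_pow (by positivity), ← ENNReal.ofReal_mul (by positivity),
          ← ENNReal.ofReal_mul (by positivity), ← ENNReal.ofReal_mul (by positivity)]
        apply ENNReal.ofReal_le_ofReal
        have hp : Real.pi^4 ≤ 97.45 := by
          calc Real.pi^4 ≤ 3.1416^4 := by gcongr; exact Real.pi_lt_d4.le
            _ ≤ _ := by norm_num
        have hs : √2^4 = 4 := by rw [show 4 = 2*2 by norm_num, pow_mul, Real.sq_sqrt (by norm_num)]; norm_num
        have : (Real.pi/2)^4 * ((2 * √2 * K)^4 * 3) = 12 * Real.pi^4 * K^4 := by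
          rw [mul_pow, mul_pow, hs]; ring
        rw [this]
        have : (0:ℝ) ≤ (K:ℝ)^4 := by positivity
        nlinarith
  exact (ENNReal.mul_le_mul_iff_right (by norm_num) (by norm_num)).1 h5
end

end PartC



section
open scoped Nat
variable {n : ℕ} (μ : Measure (Fin n → ℝ)) [IsProbabilityMeasure μ]

theorem tr_rot (hrot : ∀ O ∈ Matrix.orthogonalGroup (Fin n) ℝ, μ.map (fun x => Matrix.mulVec O x) = μ)
    (O : EuclideanSpace ℝ (Fin n) ≃ₗᵢ[ℝ] EuclideanSpace ℝ (Fin n)) :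
    (μ.map (WithLp.toLp 2)).map O = μ.map (WithLp.toLp 2 : (Fin n → ℝ) → EuclideanSpace ℝ (Fin n)) := by
  have hm : Measurable (WithLp.toLp 2 : (Fin n → ℝ) → EuclideanSpace ℝ (Fin n)) := by fun_prop
  set A : Matrix (Fin n) (Fin n) ℝ := Matrix.of (fun i j => O (EuclideanSpace.single j 1) i) with hA
  have hmul : ∀ x : Fin n → ℝ, O (WithLp.toLp 2 x) = WithLp.toLp 2 (A.mulVec x) := by
    intro x
    have hx : (WithLp.toLp 2 x : EuclideanSpace ℝ (Fin n)) = ∑ j, x j • EuclideanSpace.single j (1:ℝ) := by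
      ext i
      simp [Finset.sum_apply, Pi.single_apply]
    rw [hx, map_sum]
    ext i
    simp [Matrix.mulVec, dotProduct, hA, mul_comm]
  have hO : A ∈ Matrix.orthogonalGroup (Fin n) ℝ := by
    rw [Matrix.mem_orthogonalGroup_iff']
    ext i j
    have := O.inner_map_map (EuclideanSpace.single i (1:ℝ)) (EuclideanSpace.single j (1:ℝ))
    rw [Matrix.mul_apply, Matrix.one_apply]
    have e2 : inner ℝ (EuclideanSpace.single i (1:ℝ)) (EuclideanSpace.single j (1:ℝ)) = (if i = j then (1:ℝ) else 0) := by
      simp [EuclideanSpace.inner_single_left, Pi.single_apply]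
    rw [e2, PiLp.inner_apply] at this
    rw [← this]
    refine Finset.sum_congr rfl fun l _ => ?_
    simp [hA, mul_comm]
  rw [Measure.map_map (by fun_prop) hm]
  have : (O ∘ (WithLp.toLp 2 : (Fin n → ℝ) → EuclideanSpace ℝ (Fin n))) = (WithLp.toLp 2) ∘ (fun x => A.mulVec x) := by
    ext x : 1; exact hmul x
  rw [this, ← Measure.map_map hm (by fun_prop), hrot A hO]

theorem tr_norm (hs : ∀ᵐ x ∂μ, ∑ i, (x i)^2 = 1) :
    ∀ᵐ x ∂(μ.map (WithLp.toLp 2 : (Fin n → ℝ) → EuclideanSpace ℝ (Fin n))), ‖x‖ = 1 := by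
  rw [ae_map_iff (by fun_prop) (measurableSet_eq_fun (by fun_prop) (by fun_prop))]
  filter_upwards [hs] with x hx
  rw [EuclideanSpace.norm_eq]; simp [hx]

theorem coord_mom (hs : ∀ᵐ x ∂μ, ∑ i, (x i)^2 = 1)
    (hrot : ∀ O ∈ Matrix.orthogonalGroup (Fin n) ℝ, μ.map (fun x => Matrix.mulVec O x) = μ) (i : Fin n) (k : ℕ) :
    (n:ENNReal)^(k+1) * ∫⁻ x, ENNReal.ofReal ((x i)^(2*(k+1))) ∂μ ≤ ((2*(k+1)-1 : ℕ)‼ : ENNReal) := by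
  have hm : Measurable (WithLp.toLp 2 : (Fin n → ℝ) → EuclideanSpace ℝ (Fin n)) := by fun_prop
  have : IsProbabilityMeasure (μ.map (WithLp.toLp 2 : (Fin n → ℝ) → EuclideanSpace ℝ (Fin n))) :=
    Measure.isProbabilityMeasure_map hm.aemeasurable
  have := sph_mom (μ.map (WithLp.toLp 2 : (Fin n → ℝ) → EuclideanSpace ℝ (Fin n))) (tr_norm μ hs) (tr_rot μ hrot)
    (EuclideanSpace.single i 1) (by simp) k
  rw [finrank_euclideanSpace_fin, lintegral_map (by fun_prop) hm] at this
  refine le_trans (le_of_eq ?_) this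
  congr 1
  refine lintegral_congr fun x => ?_
  rw [enorm_pow_even]
  simp [EuclideanSpace.inner_single_left]

theorem lip_mom (hs : ∀ᵐ x ∂μ, ∑ i, (x i)^2 = 1)
    (hrot : ∀ O ∈ Matrix.orthogonalGroup (Fin n) ℝ, μ.map (fun x => Matrix.mulVec O x) = μ)
    (h : (Fin n → ℝ) → ℝ) (K : ℝ) (hK : 0 ≤ K) (hl : ∀ x y, |h x - h y| ≤ K * l2norm (x - y)) :
    (n:ENNReal)^2 * ∫⁻ x, ENNReal.ofReal ((h x - h (-x))^4) ∂μ ≤ ENNReal.ofReal (585 * K^4) := by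
  have hm : Measurable (WithLp.toLp 2 : (Fin n → ℝ) → EuclideanSpace ℝ (Fin n)) := by fun_prop
  have : IsProbabilityMeasure (μ.map (WithLp.toLp 2 : (Fin n → ℝ) → EuclideanSpace ℝ (Fin n))) :=
    Measure.isProbabilityMeasure_map hm.aemeasurable
  have hL : LipschitzWith K.toNNReal (fun x : EuclideanSpace ℝ (Fin n) => h x.ofLp) := by
    refine LipschitzWith.of_dist_le_mul fun x y => ?_
    rw [Real.dist_eq, EuclideanSpace.dist_eq]
    refine (hl _ _).trans (le_of_eq ?_)
    simp only [l2norm, Real.dist_eq, sq_abs, Real.coe_toNNReal _ hK]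
    rfl
  have := sph_lip (μ.map (WithLp.toLp 2 : (Fin n → ℝ) → EuclideanSpace ℝ (Fin n))) (tr_norm μ hs) (tr_rot μ hrot)
    _ _ hL
  have hc := hL.continuous
  have hmm : Measurable (fun x : EuclideanSpace ℝ (Fin n) => ‖h x.ofLp - h (-x).ofLp‖ₑ ^ 4) :=
    (hc.sub (hc.comp continuous_neg)).measurable.enorm.pow_const 4
  rw [finrank_euclideanSpace_fin, lintegral_map hmm hm, Real.coe_toNNReal _ hK] at this
  refine le_trans (le_of_eq ?_) this
  congr 1
  refine lintegral_congr fun x => ?_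
  rw [show 4 = 2 * 2 from rfl, enorm_pow_even]
  simp
end



section
variable {n : ℕ}

theorem lpn_nonneg (q : ℝ) (x : Fin n → ℝ) : 0 ≤ lpnorm q x := by
  unfold lpnorm; positivity

theorem lpn_meas (q : ℝ) : Measurable (fun x : Fin n → ℝ => lpnorm q x) := by
  unfold lpnorm; fun_prop

theorem lpn_pow (q : ℝ) (hq : 0 < q) (x : Fin n → ℝ) : lpnorm q x ^ q = ∑ i, |x i| ^ q := by
  unfold lpnorm
  rw [← Real.rpow_mul (by positivity)]
  field_simp
  simp

theorem lpn_coord (q : ℝ) (hq : 0 < q) (x : Fin n → ℝ) (i : Fin n) : |x i| ≤ lpnorm q x := by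
  rw [← Real.rpow_le_rpow_iff (abs_nonneg _) (lpn_nonneg _ _) hq, lpn_pow q hq]
  exact Finset.single_le_sum (f := fun i => |x i| ^ q) (fun i _ => by positivity) (Finset.mem_univ i)

theorem lpn_anti (q r : ℝ) (hr : 0 < r) (hrq : r ≤ q) (x : Fin n → ℝ) : lpnorm q x ≤ lpnorm r x := by
  have hq : 0 < q := lt_of_lt_of_le hr hrq
  rw [← Real.rpow_le_rpow_iff (lpn_nonneg _ _) (lpn_nonneg _ _) hq, lpn_pow q hq]
  have h1 : ∀ i, |x i| ^ q ≤ |x i| ^ r * lpnorm r x ^ (q - r) := by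
    intro i
    have : |x i| ^ q = |x i| ^ r * |x i| ^ (q - r) := by
      rw [← Real.rpow_add_of_nonneg (abs_nonneg _) hr.le (by linarith)]; congr 1; ring
    rw [this]
    have h5 := lpn_coord r hr x i
    have h6 : 0 ≤ q - r := by linarith
    gcongr
  calc _ ≤ ∑ i, |x i| ^ r * lpnorm r x ^ (q - r) := Finset.sum_le_sum fun i _ => h1 i
    _ = lpnorm r x ^ r * lpnorm r x ^ (q - r) := by rw [← Finset.sum_mul, lpn_pow r hr]
    _ = _ := by
      rw [← Real.rpow_add_of_nonneg (lpn_nonneg _ _) hr.le (by linarith)]; congr 1; ring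

theorem lpn_pm (q r : ℝ) (hq : 0 < q) (hrq : q ≤ r) (x : Fin n → ℝ) :
    lpnorm q x ≤ (n:ℝ)^(1/q-1/r) * lpnorm r x := by
  have hr : 0 < r := lt_of_lt_of_le hq hrq
  have h := Real.rpow_sum_le_const_mul_sum_rpow_of_nonneg (s := Finset.univ) (f := fun i => |x i| ^ q)
    (p := r / q) (by rwa [le_div_iff₀ hq, one_mul]) (fun i _ => by positivity)
  have h2 : ∀ i, (|x i| ^ q) ^ (r / q) = |x i| ^ r := by
    intro i; rw [← Real.rpow_mul (abs_nonneg _)]; congr 1; field_simp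
  simp only [h2, Finset.card_univ, Fintype.card_fin] at h
  have h3 := Real.rpow_le_rpow (by positivity) h (show 0 ≤ 1 / r by positivity)
  rw [Real.mul_rpow (by positivity) (by positivity), ← Real.rpow_mul (by positivity),
    ← Real.rpow_mul (by positivity)] at h3
  unfold lpnorm
  convert h3 using 2
  · field_simp
  · congr 1; field_simp

theorem lpn_two (x : Fin n → ℝ) (hx : ∑ i, (x i)^2 = 1) : lpnorm 2 x = 1 := by
  unfold lpnorm; simp [hx]

theorem lpn_smul (q c : ℝ) (hq : 0 < q) (x y : Fin n → ℝ) (h : ∀ i, |y i| = |c| * |x i|) :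
    lpnorm q y = |c| * lpnorm q x := by
  unfold lpnorm
  simp_rw [h, Real.mul_rpow (abs_nonneg c) (abs_nonneg _), ← Finset.mul_sum]
  rw [Real.mul_rpow (by positivity) (by positivity), ← Real.rpow_mul (by positivity)]
  rw [mul_one_div_cancel hq.ne', Real.rpow_one]

variable (μ : Measure (Fin n → ℝ)) [IsProbabilityMeasure μ]

theorem lpn_le_one (hs : ∀ᵐ x ∂μ, ∑ i, (x i)^2 = 1) (q : ℝ) (hq : 2 ≤ q) : ∀ᵐ x ∂μ, lpnorm q x ≤ 1 := by
  filter_upwards [hs] with x hx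
  rw [← lpn_two x hx]
  exact lpn_anti q 2 (by norm_num) hq x

theorem lpn_int (hs : ∀ᵐ x ∂μ, ∑ i, (x i)^2 = 1) (q : ℝ) (hq : 2 ≤ q) (m : ℕ) :
    Integrable (fun x => lpnorm q x ^ m) μ := by
  refine Integrable.of_bound ((lpn_meas q).pow_const m).aestronglyMeasurable 1 ?_
  filter_upwards [lpn_le_one μ hs q hq] with x hx
  rw [Real.norm_of_nonneg (pow_nonneg (lpn_nonneg _ _) _)]
  exact pow_le_one₀ (lpn_nonneg _ _) hx

theorem I_anti (hs : ∀ᵐ x ∂μ, ∑ i, (x i)^2 = 1) (q r : ℝ) (hr : 2 ≤ r) (hrq : r ≤ q) :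
    ∫ x, lpnorm q x ^ 4 ∂μ ≤ ∫ x, lpnorm r x ^ 4 ∂μ := by
  refine integral_mono (lpn_int μ hs q (by linarith) 4) (lpn_int μ hs r hr 4) fun x => ?_
  have := lpn_anti q r (by linarith) hrq x
  have := lpn_nonneg q x
  simp only; gcongr

theorem I_pm (hn : 0 < n) (hs : ∀ᵐ x ∂μ, ∑ i, (x i)^2 = 1) (q r K : ℝ) (hq : 2 ≤ q) (hrq : q ≤ r)
    (h : ∫ x, lpnorm r x ^ 4 ∂μ ≤ (K * (n:ℝ)^(2/r-1))^2) :
    ∫ x, lpnorm q x ^ 4 ∂μ ≤ (K * (n:ℝ)^(2/q-1))^2 := by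
  have hn' : (0:ℝ) < n := by exact_mod_cast hn
  have h1 : ∫ x, lpnorm q x ^ 4 ∂μ ≤ ∫ x, ((n:ℝ)^(1/q-1/r))^4 * lpnorm r x ^ 4 ∂μ := by
    refine integral_mono (lpn_int μ hs q hq 4) ((lpn_int μ hs r (by linarith) 4).const_mul _) fun x => ?_
    have := lpn_pm q r (by linarith) hrq x
    have := lpn_nonneg q x
    simp only; rw [← mul_pow]; gcongr
  rw [integral_const_mul] at h1
  refine h1.trans ((mul_le_mul_of_nonneg_left h (by positivity)).trans (le_of_eq ?_))
  have : (n:ℝ)^(2/q-1) = ((n:ℝ)^(1/q-1/r))^2 * (n:ℝ)^(2/r-1) := by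
    rw [← Real.rpow_natCast, ← Real.rpow_mul hn'.le, ← Real.rpow_add hn']
    congr 1; push_cast; ring
  rw [this]; ring

theorem jens {α : Type*} [MeasurableSpace α] (μ : Measure α) [IsProbabilityMeasure μ] (s : α → ℝ)
    (h0 : ∀ x, 0 ≤ s x) (hi : Integrable s μ) (c θ : ℝ) (hc : ∫ x, s x ∂μ ≤ c) (t0 : 0 ≤ θ) (t1 : θ ≤ 1) :
    ∫ x, s x ^ θ ∂μ ≤ c ^ θ := by
  have hp : 0 ≤ ∫ x, s x ∂μ := integral_nonneg h0
  by_cases hj : Integrable (fun x => s x ^ θ) μ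
  · refine le_trans ?_ (Real.rpow_le_rpow hp hc t0)
    exact (Real.concaveOn_rpow t0 t1).le_map_integral (Real.continuous_rpow_const t0).continuousOn
      isClosed_Ici (Filter.Eventually.of_forall h0) hi hj
  · rw [integral_undef hj]; exact Real.rpow_nonneg (hp.trans hc) _

open scoped Nat in
theorem S_mom (hn : 0 < n) (hs : ∀ᵐ x ∂μ, ∑ i, (x i)^2 = 1)
    (hrot : ∀ O ∈ Matrix.orthogonalGroup (Fin n) ℝ, μ.map (fun x => Matrix.mulVec O x) = μ) (k : ℕ) (hk : 1 ≤ k) :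
    Integrable (fun x => ∑ i, (x i)^(2*k)) μ ∧
    ∫ x, ∑ i, (x i)^(2*k) ∂μ ≤ n * ((2*k-1 : ℕ)‼ / (n:ℝ)^k) := by
  obtain ⟨k, rfl⟩ : ∃ j, k = j + 1 := ⟨k - 1, by omega⟩
  have hn' : (0:ℝ) < n := by exact_mod_cast hn
  have hi : ∀ i, Integrable (fun x : Fin n → ℝ => (x i)^(2*(k+1))) μ := by
    intro i
    refine Integrable.of_bound (Measurable.aestronglyMeasurable (by fun_prop)) 1 ?_
    filter_upwards [hs] with x hx
    rw [Real.norm_of_nonneg (by rw [pow_mul]; positivity), pow_mul]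
    refine pow_le_one₀ (by positivity) ?_
    rw [← hx]
    exact Finset.single_le_sum (f := fun i => (x i) ^ 2) (fun i _ => by positivity) (Finset.mem_univ i)
  refine ⟨integrable_finsetSum _ fun i _ => hi i, ?_⟩
  rw [integral_finsetSum _ fun i _ => hi i]
  have : ∀ i, ∫ x, (x i)^(2*(k+1)) ∂μ ≤ (2*(k+1)-1 : ℕ)‼ / (n:ℝ)^(k+1) := by
    intro i
    have h := coord_mom μ hs hrot i k
    rw [← ofReal_integral_eq_lintegral_ofReal (hi i) (Filter.Eventually.of_forall fun x => by
      simp only [Pi.zero_apply]; rw [pow_mul]; positivity)] at h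
    rw [← ENNReal.ofReal_natCast n, ← ENNReal.ofReal_natCast, ← ENNReal.ofReal_pow (by positivity),
      ← ENNReal.ofReal_mul (by positivity), ENNReal.ofReal_le_ofReal_iff (by positivity)] at h
    rw [le_div_iff₀ (by positivity)]; linarith
  calc _ ≤ ∑ i : Fin n, ((2*(k+1)-1 : ℕ)‼ / (n:ℝ)^(k+1) : ℝ) := Finset.sum_le_sum fun i _ => this i
    _ = _ := by simp

theorem I_even (hn : 0 < n) (hs : ∀ᵐ x ∂μ, ∑ i, (x i)^2 = 1)
    (hrot : ∀ O ∈ Matrix.orthogonalGroup (Fin n) ℝ, μ.map (fun x => Matrix.mulVec O x) = μ) (k : ℕ) (hk : 2 ≤ k) :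
    ∫ x, lpnorm (2*k : ℝ) x ^ 4 ∂μ ≤ ((k:ℝ) * (n:ℝ)^(2/(2*k:ℝ)-1))^2 := by
  have hn' : (0:ℝ) < n := by exact_mod_cast hn
  have hk' : (2:ℝ) ≤ k := by exact_mod_cast hk
  have hk0 : (0:ℝ) < k := by linarith
  obtain ⟨hi, hb⟩ := S_mom μ hn hs hrot k (by omega)
  have hb2 : ∫ x, ∑ i, (x i)^(2*k) ∂μ ≤ n * ((k:ℝ)^k / (n:ℝ)^k) := by
    refine hb.trans ?_
    gcongr
    exact_mod_cast dfle k
  have := jens μ (fun x => ∑ i, (x i)^(2*k)) (fun x => Finset.sum_nonneg fun i _ => by rw [pow_mul]; positivity) hi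
    _ (2/k) hb2 (by positivity) (by rw [div_le_one hk0]; exact hk')
  have e : ∀ x : Fin n → ℝ, lpnorm (2*k : ℝ) x ^ 4 = (∑ i, (x i)^(2*k))^(2/k:ℝ) := by
    intro x
    have e1 : ∀ i, |x i| ^ (2*k:ℝ) = (x i)^(2*k) := by
      intro i
      rw [show (2*k:ℝ) = ((2*k:ℕ):ℝ) by push_cast; ring, Real.rpow_natCast, Even.pow_abs ⟨k, by ring⟩]
    unfold lpnorm
    simp_rw [e1]
    rw [← Real.rpow_natCast, ← Real.rpow_mul (Finset.sum_nonneg fun i _ => by rw [pow_mul]; positivity)]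
    congr 1; field_simp; norm_num
  simp_rw [e]
  refine this.trans (le_of_eq ?_)
  rw [← Real.rpow_natCast (k:ℝ) k, ← Real.rpow_natCast (n:ℝ) k, Real.mul_rpow hn'.le (by positivity),
    Real.div_rpow (by positivity) (by positivity), ← Real.rpow_mul hk0.le, ← Real.rpow_mul hn'.le]
  rw [show (k:ℝ) * (2/k) = (2:ℕ) by field_simp; norm_num, Real.rpow_natCast, Real.rpow_natCast, mul_pow, ← Real.rpow_natCast ((n:ℝ)^(_:ℝ)), ← Real.rpow_mul hn'.le]
  rw [show (2 / (2*k) - 1 : ℝ) * (2:ℕ) = 2/k - (2:ℕ) by push_cast; field_simp, Real.rpow_sub hn', Real.rpow_natCast]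
  ring

theorem I_three (hn : 0 < n) (hs : ∀ᵐ x ∂μ, ∑ i, (x i)^2 = 1)
    (hrot : ∀ O ∈ Matrix.orthogonalGroup (Fin n) ℝ, μ.map (fun x => Matrix.mulVec O x) = μ) :
    ∫ x, lpnorm 3 x ^ 4 ∂μ ≤ ((3:ℝ)^(1/3:ℝ) * (n:ℝ)^(2/3-1:ℝ))^2 := by
  have hn' : (0:ℝ) < n := by exact_mod_cast hn
  obtain ⟨hi, hb⟩ := S_mom μ hn hs hrot 2 (by omega)
  have hb2 : ∫ x, ∑ i, (x i)^(2*2) ∂μ ≤ 3 / n := by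
    refine hb.trans (le_of_eq ?_)
    norm_num [Nat.doubleFactorial]
    field_simp
  have h0 : ∀ x : Fin n → ℝ, 0 ≤ ∑ i, (x i)^(2*2) := fun x => Finset.sum_nonneg fun i _ => by rw [pow_mul]; positivity
  have := jens μ (fun x => ∑ i, (x i)^(2*2)) h0 hi
    _ (2/3) hb2 (by positivity) (by norm_num)
  have e : ∀ᵐ x ∂μ, lpnorm 3 x ^ 4 ≤ (∑ i, (x i)^(2*2))^(2/3:ℝ) := by
    filter_upwards [hs] with x hx
    have c : (∑ i, |x i| ^ 3)^2 ≤ ∑ i, (x i)^(2*2) := by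
      have := Finset.sum_mul_sq_le_sq_mul_sq Finset.univ (fun i => |x i|) (fun i => |x i|^2)
      simp only [sq_abs, hx, one_mul] at this
      have a1 : ∑ i, |x i| ^ 3 = ∑ i, |x i| * x i ^ 2 :=
        Finset.sum_congr rfl fun i _ => by rw [← sq_abs]; ring
      have a2 : ∑ i, (x i)^(2*2) = ∑ i, (x i ^ 2) ^ 2 :=
        Finset.sum_congr rfl fun i _ => by ring
      rw [a1, a2]; exact this
    have e1 : ∀ i, |x i| ^ (3:ℝ) = |x i|^3 := fun i => by
      rw [← Real.rpow_natCast]; norm_num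
    have e2 : lpnorm 3 x ^ 4 = ((∑ i, |x i| ^ 3)^2)^(2/3:ℝ) := by
      unfold lpnorm
      simp_rw [e1]
      rw [← Real.rpow_natCast, ← Real.rpow_mul (by positivity), ← Real.rpow_natCast _ 2, ← Real.rpow_mul (by positivity)]
      norm_num
    rw [e2]
    gcongr
  have hint : Integrable (fun x : Fin n → ℝ => (∑ i, (x i)^(2*2))^(2/3:ℝ)) μ := by
    refine Integrable.of_bound (Measurable.aestronglyMeasurable (by fun_prop)) 1 ?_
    filter_upwards [hs] with x hx
    rw [Real.norm_of_nonneg (Real.rpow_nonneg (h0 x) _)]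
    refine Real.rpow_le_one (h0 x) ?_ (by norm_num)
    rw [← hx]
    refine Finset.sum_le_sum fun i _ => ?_
    have : (x i)^2 ≤ 1 := by
      rw [← hx]
      exact Finset.single_le_sum (f := fun i => (x i) ^ 2) (fun i _ => by positivity) (Finset.mem_univ i)
    rw [pow_mul]; nlinarith [sq_nonneg (x i)]
  refine (integral_mono_ae (lpn_int μ hs 3 (by norm_num) 4) hint e).trans (this.trans (le_of_eq ?_))
  rw [Real.div_rpow (by positivity) (by positivity), mul_pow, ← Real.rpow_natCast, ← Real.rpow_natCast, ← Real.rpow_mul (by positivity), ← Real.rpow_mul (by positivity)]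
  norm_num
  rw [div_eq_mul_inv, Real.rpow_neg hn'.le]
end


section
variable {n : ℕ} (μ : Measure (Fin n → ℝ)) [IsProbabilityMeasure μ]

theorem I_aux (I K m w : ℝ) (hK : 0 ≤ K) (hw : 0 ≤ w) (h : I ≤ (K * w)^2) (hm : 24.2 * K ≤ 12 * m) :
    585 * I ≤ (12 * (m * w))^2 := by
  have h1 : (24.2 * K * w)^2 ≤ (12 * m * w)^2 := by gcongr
  nlinarith [sq_nonneg (K*w)]

theorem I_one (hn : 3 ≤ n) (hs : ∀ᵐ x ∂μ, ∑ i, (x i)^2 = 1)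
    (hrot : ∀ O ∈ Matrix.orthogonalGroup (Fin n) ℝ, μ.map (fun x => Matrix.mulVec O x) = μ)
    (q : ℝ) (hq : 2 ≤ q) :
    585 * ∫ x, lpnorm q x ^ 4 ∂μ ≤ (12 * ((2 * q - 1) * (n:ℝ)^(2/q-1)))^2 := by
  have hw : 0 ≤ (n:ℝ)^(2/q-1) := by positivity
  by_cases h3 : q ≤ 3
  · have h := I_pm μ (by omega) hs q 3 _ hq h3 (I_three μ (by omega) hs hrot)
    refine I_aux _ _ _ _ (by positivity) hw h ?_
    have hc : ((3:ℝ)^(1/3:ℝ))^3 = 3 := by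
      rw [← Real.rpow_natCast, ← Real.rpow_mul (by norm_num)]; norm_num
    have : (3:ℝ)^(1/3:ℝ) ≤ 1.45 := by
      by_contra hcon
      push Not at hcon
      have : (1.45:ℝ)^3 < ((3:ℝ)^(1/3:ℝ))^3 := by gcongr
      rw [hc] at this; norm_num at this
    linarith
  · push Not at h3
    set k := ⌈q/2⌉₊ with hk
    have k1 : q/2 ≤ k := Nat.le_ceil _
    have k2 : (k:ℝ) < q/2 + 1 := Nat.ceil_lt_add_one (by linarith)
    have k3 : 2 ≤ k := by
      have : (1:ℝ) < k := by linarith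
      exact_mod_cast this
    have h := I_pm μ (by omega) hs q (2*k) _ hq (by linarith) (I_even μ (by omega) hs hrot k k3)
    refine I_aux _ _ _ _ (by positivity) hw h ?_
    rcases Nat.eq_or_lt_of_le k3 with h2 | h2
    · rw [← h2]; norm_num; linarith
    · have : (3:ℝ) ≤ k := by exact_mod_cast h2
      linarith

theorem I_min (hn : 3 ≤ n) (hs : ∀ᵐ x ∂μ, ∑ i, (x i)^2 = 1)
    (hrot : ∀ O ∈ Matrix.orthogonalGroup (Fin n) ℝ, μ.map (fun x => Matrix.mulVec O x) = μ)
    (q : ℝ) (hq : 2 ≤ q) :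
    1 ≤ min (2 * q - 1) (32 * Real.log n - 8) ∧
    585 * ∫ x, lpnorm q x ^ 4 ∂μ ≤ (12 * (min (2 * q - 1) (32 * Real.log n - 8) * (n:ℝ)^(2/q-1)))^2 := by
  have hn' : (3:ℝ) ≤ n := by exact_mod_cast hn
  have hL : 1 < Real.log n := by
    rw [Real.lt_log_iff_exp_lt (by linarith)]
    linarith [Real.exp_one_lt_d9]
  set L := Real.log n with hLd
  have hone := I_one μ hn hs hrot q hq
  refine ⟨le_min (by linarith) (by linarith), ?_⟩
  rcases le_total (2 * q - 1) (32 * L - 8) with hm | hm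
  · rw [min_eq_left hm]; exact hone
  · rw [min_eq_right hm]
    have hw : 0 ≤ (n:ℝ)^(2/q-1) := by positivity
    set k := ⌈L⌉₊ with hk
    have k1 : L ≤ k := Nat.le_ceil _
    have k2 : (k:ℝ) < L + 1 := Nat.ceil_lt_add_one (by linarith)
    have k3 : 2 ≤ k := by
      have : (1:ℝ) < k := by linarith
      exact_mod_cast this
    have k4 : (0:ℝ) < k := by linarith
    have hqk : 2 * (k:ℝ) ≤ q := by linarith
    have h := (I_anti μ hs q (2*k) (by linarith) hqk).trans (I_even μ (by omega) hs hrot k k3)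
    refine I_aux _ (2.72 * k) _ _ (by positivity) hw ?_ (by linarith)
    refine h.trans ?_
    have e1 : (n:ℝ)^(2/(2*k:ℝ)) ≤ 2.72 := by
      rw [Real.rpow_def_of_pos (by linarith)]
      have h9 : L * (2/(2*k)) ≤ 1 := by
        rw [show L * (2/(2*k)) = L / k by field_simp, div_le_one k4]; exact k1
      refine le_trans (Real.exp_le_exp.mpr h9) ?_
      have := Real.exp_one_lt_d9
      norm_num at this ⊢
      linarith
    have e2 : 1 ≤ (n:ℝ)^(2/q) := Real.one_le_rpow (by linarith) (by positivity)
    have e3 : (n:ℝ)^(2/(2*k:ℝ)-1) ≤ 2.72 * (n:ℝ)^(2/q-1) := by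
      rw [Real.rpow_sub (by linarith), Real.rpow_sub (by linarith), ← mul_div_assoc]
      gcongr
      linarith
    have : (k:ℝ) * (n:ℝ)^(2/(2*k:ℝ)-1) ≤ 2.72 * k * (n:ℝ)^(2/q-1) := by
      nlinarith
    gcongr
end


section
variable {n : ℕ} (μ : Measure (Fin n → ℝ)) [IsProbabilityMeasure μ]

theorem cs_bd (hn : 0 < n) (hs : ∀ᵐ x ∂μ, ∑ i, (x i)^2 = 1)
    (hrot : ∀ O ∈ Matrix.orthogonalGroup (Fin n) ℝ, μ.map (fun x => Matrix.mulVec O x) = μ)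
    (q a : ℝ) (hq : 2 ≤ q) (ha : 0 < a) (hI : 585 * ∫ x, lpnorm q x ^ 4 ∂μ ≤ (12 * a)^2)
    (h : (Fin n → ℝ) → ℝ) (hmeas : Measurable h) (K : ℝ) (hK : 0 ≤ K)
    (hl : ∀ x y, |h x - h y| ≤ K * l2norm (x - y)) :
    ∫⁻ x, ENNReal.ofReal ((h x - h (-x))^2 * lpnorm q x ^ 2) ∂μ ≤ ENNReal.ofReal (12 / n * K^2 * a) := by
  have hn' : (0:ℝ) < n := by exact_mod_cast hn
  rcases hK.eq_or_lt with rfl | hK0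
  · have : ∀ x, h x - h (-x) = 0 := fun x => by
      have := hl x (-x); rw [zero_mul] at this; exact abs_nonpos_iff.mp this
    simp [this]
  have h1 := lip_mom μ hs hrot h K hK hl
  have h1' : ∫⁻ x, ENNReal.ofReal ((h x - h (-x))^4) ∂μ ≤ ENNReal.ofReal (585 * K^4 / n^2) := by
    rw [ENNReal.ofReal_div_of_pos (by positivity), ENNReal.le_div_iff_mul_le, mul_comm]
    · rwa [ENNReal.ofReal_pow hn'.le, ENNReal.ofReal_natCast]
    · left; simp [hn'.ne', ENNReal.ofReal_eq_zero]; positivity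
    · left; exact ENNReal.ofReal_ne_top
  have h2 : ∫⁻ x, ENNReal.ofReal (lpnorm q x ^ 4) ∂μ ≤ ENNReal.ofReal ((12*a)^2/585) := by
    rw [← ofReal_integral_eq_lintegral_ofReal (lpn_int μ hs q hq 4)
      (Filter.Eventually.of_forall fun x => pow_nonneg (lpn_nonneg _ _) _)]
    apply ENNReal.ofReal_le_ofReal
    linarith
  set t := 12 * a * n / (585 * K^2) with ht
  have ht0 : 0 < t := by positivity
  calc _ ≤ ∫⁻ x, (ENNReal.ofReal (t/2) * ENNReal.ofReal ((h x - h (-x))^4)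
            + ENNReal.ofReal (1/(2*t)) * ENNReal.ofReal (lpnorm q x ^ 4)) ∂μ := by
        refine lintegral_mono fun x => ?_
        rw [← ENNReal.ofReal_mul (by positivity), ← ENNReal.ofReal_mul (by positivity),
          ← ENNReal.ofReal_add (by positivity) (mul_nonneg (by positivity) (pow_nonneg (lpn_nonneg _ _) _))]
        apply ENNReal.ofReal_le_ofReal
        have : t/2 * (h x - h (-x))^4 + 1/(2*t) * lpnorm q x ^ 4 - (h x - h (-x))^2 * lpnorm q x ^ 2
          = (t * (h x - h (-x))^2 - lpnorm q x ^ 2)^2 / (2 * t) := by field_simp; ring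
        have h3 : 0 ≤ (t * (h x - h (-x))^2 - lpnorm q x ^ 2)^2 / (2 * t) := by positivity
        linarith
    _ = ENNReal.ofReal (t/2) * ∫⁻ x, ENNReal.ofReal ((h x - h (-x))^4) ∂μ
          + ENNReal.ofReal (1/(2*t)) * ∫⁻ x, ENNReal.ofReal (lpnorm q x ^ 4) ∂μ := by
        have hm1 : Measurable fun x => ENNReal.ofReal ((h x - h (-x))^4) := by fun_prop
        have hm2 : Measurable fun x : Fin n → ℝ => ENNReal.ofReal (lpnorm q x ^ 4) := 
          ((lpn_meas q).pow_const 4).ennreal_ofReal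
        rw [lintegral_add_left (hm1.const_mul _), lintegral_const_mul _ hm1, lintegral_const_mul _ hm2]
    _ ≤ ENNReal.ofReal (t/2) * ENNReal.ofReal (585 * K^4 / n^2) + ENNReal.ofReal (1/(2*t)) * ENNReal.ofReal ((12*a)^2/585) := by
        gcongr
    _ = _ := by
        rw [← ENNReal.ofReal_mul (by positivity), ← ENNReal.ofReal_mul (by positivity),
          ← ENNReal.ofReal_add (by positivity) (by positivity)]
        congr 1
        rw [ht]; field_simp; ring

theorem N2_bd (hs : ∀ᵐ x ∂μ, ∑ i, (x i)^2 = 1)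
    (q a : ℝ) (hq : 2 ≤ q) (ha : 0 < a) (hI : 585 * ∫ x, lpnorm q x ^ 4 ∂μ ≤ (12 * a)^2) :
    ∫⁻ x, ENNReal.ofReal (lpnorm q x ^ 2) ∂μ ≤ ENNReal.ofReal a := by
  rw [← ofReal_integral_eq_lintegral_ofReal (lpn_int μ hs q hq 2)
      (Filter.Eventually.of_forall fun x => pow_nonneg (lpn_nonneg _ _) _)]
  apply ENNReal.ofReal_le_ofReal
  have : ∫ x, lpnorm q x ^ 2 ∂μ ≤ ∫ x, ((1/(2*a)) * lpnorm q x ^ 4 + a/2) ∂μ := by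
    refine integral_mono (lpn_int μ hs q hq 2) (((lpn_int μ hs q hq 4).const_mul _).add (integrable_const _)) fun x => ?_
    have : 1/(2*a) * lpnorm q x ^ 4 + a/2 - lpnorm q x ^ 2 = (lpnorm q x ^ 2 - a)^2 / (2*a) := by
      field_simp; ring
    have h3 : 0 ≤ (lpnorm q x ^ 2 - a)^2 / (2*a) := by positivity
    simp only; linarith
  rw [integral_add ((lpn_int μ hs q hq 4).const_mul _) (integrable_const _), integral_const_mul] at this
  simp only [integral_const, probReal_univ, one_smul] at this
  have h4 : 1/(2*a) * ∫ x, lpnorm q x ^ 4 ∂μ ≤ 1/(2*a) * ((12*a)^2/585) := by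
    gcongr; linarith
  have h5 : 1/(2*a) * ((12*a)^2/585) = 72/585 * a := by field_simp; ring
  linarith
end

theorem asm_bd {Ω : Type*} [MeasurableSpace Ω] (P : Measure Ω) (A B G : Ω → ℝ) (c d u v : ℝ)
    (hc : 0 ≤ c) (hd : 0 ≤ d) (hu : 0 ≤ u) (hv : 0 ≤ v) (hA : ∀ ω, 0 ≤ A ω) (hB : ∀ ω, 0 ≤ B ω)
    (hG : ∀ ω, 0 ≤ G ω) (mB : Measurable fun ω => ENNReal.ofReal (B ω))
    (hpt : ∀ ω, G ω ≤ c * A ω + d * B ω)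
    (h1 : ∫⁻ ω, ENNReal.ofReal (A ω) ∂P ≤ ENNReal.ofReal u)
    (h2 : ∫⁻ ω, ENNReal.ofReal (B ω) ∂P ≤ ENNReal.ofReal v) :
    ∫ ω, G ω ∂P ≤ c * u + d * v := by
  have hfin : ∫⁻ ω, ENNReal.ofReal (G ω) ∂P ≤ ENNReal.ofReal (c * u + d * v) := by
    calc _ ≤ ∫⁻ ω, (ENNReal.ofReal c * ENNReal.ofReal (A ω) + ENNReal.ofReal d * ENNReal.ofReal (B ω)) ∂P := by
          refine lintegral_mono fun ω => ?_
          rw [← ENNReal.ofReal_mul hc, ← ENNReal.ofReal_mul hd,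
            ← ENNReal.ofReal_add (mul_nonneg hc (hA ω)) (mul_nonneg hd (hB ω))]
          exact ENNReal.ofReal_le_ofReal (hpt ω)
      _ = ENNReal.ofReal c * ∫⁻ ω, ENNReal.ofReal (A ω) ∂P
          + ENNReal.ofReal d * ∫⁻ ω, ENNReal.ofReal (B ω) ∂P := by
          rw [lintegral_add_right _ (mB.const_mul _), lintegral_const_mul' _ _ ENNReal.ofReal_ne_top,
            lintegral_const_mul _ mB]
      _ ≤ ENNReal.ofReal c * ENNReal.ofReal u + ENNReal.ofReal d * ENNReal.ofReal v := by gcongr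
      _ = _ := by
          rw [← ENNReal.ofReal_mul hc, ← ENNReal.ofReal_mul hd,
            ← ENNReal.ofReal_add (mul_nonneg hc hu) (mul_nonneg hd hv)]
  by_cases hint : Integrable G P
  · rw [← ofReal_integral_eq_lintegral_ofReal hint (Filter.Eventually.of_forall hG),
      ENNReal.ofReal_le_ofReal_iff (by positivity)] at hfin
    exact hfin
  · rw [integral_undef hint]; positivity

set_option maxHeartbeats 1000000 in
theorem main_aux (nx ny : ℕ) (hn : 3 ≤ nx + ny) (q : ℝ) (hq : 2 ≤ q)
    (z : Fin (nx + ny) → ℝ) (τ : ℝ) (hτ : 0 < τ) (Δ : ℝ) (hΔ : 0 ≤ Δ)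
    {Ω : Type*} [MeasureSpace Ω] [IsProbabilityMeasure (ℙ : Measure Ω)]
    {Ξ : Type*} [MeasurableSpace Ξ]
    (e : Ω → Fin (nx + ny) → ℝ) (he : Measurable e)
    (hsphere : ∀ᵐ ω ∂ℙ, ∑ i, (e ω i) ^ 2 = 1)
    (hrot : ∀ O ∈ Matrix.orthogonalGroup (Fin (nx + ny)) ℝ,
      Measure.map (fun ω => Matrix.mulVec O (e ω)) ℙ = Measure.map e ℙ)
    (ξ : Ω → Ξ) (hξ : Measurable ξ)
    (hindep : IndepFun e ξ ℙ)
    (f : (Fin (nx + ny) → ℝ) → Ξ → ℝ)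
    (hf : Measurable (fun p : (Fin (nx + ny) → ℝ) × Ξ => f p.1 p.2))
    (Mf : Ξ → ℝ) (hMf : ∀ x, 0 ≤ Mf x)
    (hLip : ∀ x z₁ z₂, |f z₁ x - f z₂ x| ≤ Mf x * l2norm (z₁ - z₂))
    (M : ℝ) (hM : 0 ≤ M)
    (hMint : Integrable (fun ω => (Mf (ξ ω)) ^ 2) ℙ)
    (hMmom : ∫ ω, (Mf (ξ ω)) ^ 2 ∂ℙ = M ^ 2)
    (δ : (Fin (nx + ny) → ℝ) → ℝ) (hδm : Measurable δ) (hδ : ∀ z', |δ z'| ≤ Δ)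
    (g : Ω → Fin (nx + ny) → ℝ)
    (hg : ∀ ω, g ω = fun (i : Fin (nx + ny)) =>
      ((nx + ny : ℝ) / (2 * τ)) *
        ((f (z + τ • e ω) (ξ ω) + δ (z + τ • e ω))
          - (f (z - τ • e ω) (ξ ω) + δ (z - τ • e ω))) *
        (if i.val < nx then e ω i else -(e ω i))) :
    ∫ ω, (lpnorm q (g ω)) ^ 2 ∂ℙ ≤
      2 * (3 * (nx + ny) * M ^ 2 + (nx + ny : ℝ) ^ 2 * Δ ^ 2 / τ ^ 2) *
        (min (2 * q - 1) (32 * Real.log (nx + ny) - 8) * (nx + ny : ℝ) ^ (2 / q - 1)) := by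
  have hnc : (nx + ny : ℝ) = ((nx + ny : ℕ) : ℝ) := by push_cast; rfl
  simp only [hnc] at hg ⊢
  generalize hN : nx + ny = n at *
  have hn3 : (3:ℝ) ≤ n := by exact_mod_cast hn
  have hn0 : (0:ℝ) < n := by linarith
  set μ := Measure.map e ℙ with hμ
  have hpμ : IsProbabilityMeasure μ := Measure.isProbabilityMeasure_map he.aemeasurable
  have hs : ∀ᵐ x ∂μ, ∑ i, (x i)^2 = 1 := by
    rw [hμ, ae_map_iff he.aemeasurable (measurableSet_eq_fun (by fun_prop) (by fun_prop))]
    exact hsphere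
  have hr : ∀ O ∈ Matrix.orthogonalGroup (Fin n) ℝ, μ.map (fun x => Matrix.mulVec O x) = μ := by
    intro O hO
    have hOm : Measurable (fun x : Fin n → ℝ => Matrix.mulVec O x) := by fun_prop
    rw [hμ, Measure.map_map hOm he]
    exact hrot O hO
  obtain ⟨hm1, hI⟩ := I_min μ hn hs hr q hq
  set a := min (2 * q - 1) (32 * Real.log n - 8) * (n : ℝ) ^ (2 / q - 1) with hadef
  have ha : 0 < a := mul_pos (by linarith) (by positivity)
  clear_value a
  -- the function part
  have hFm : Measurable (fun p : (Fin n → ℝ) × Ξ =>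
      ENNReal.ofReal ((f (z + τ • p.1) p.2 - f (z - τ • p.1) p.2)^2 * lpnorm q p.1 ^ 2)) := by
    have m1 : Measurable (fun p : (Fin n → ℝ) × Ξ => f (z + τ • p.1) p.2) :=
      hf.comp (f := fun p : (Fin n → ℝ) × Ξ => (z + τ • p.1, p.2)) (by fun_prop)
    have m2 : Measurable (fun p : (Fin n → ℝ) × Ξ => f (z - τ • p.1) p.2) :=
      hf.comp (f := fun p : (Fin n → ℝ) × Ξ => (z - τ • p.1, p.2)) (by fun_prop)
    exact (((m1.sub m2).pow_const 2).mul (((lpn_meas q).comp measurable_fst).pow_const 2)).ennreal_ofReal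
  have hF : ∫⁻ ω, ENNReal.ofReal ((f (z + τ • e ω) (ξ ω) - f (z - τ • e ω) (ξ ω))^2 * lpnorm q (e ω) ^ 2) ∂ℙ
      ≤ ENNReal.ofReal (12 / n * τ^2 * a * M^2) := by
    have hpξ : IsProbabilityMeasure (Measure.map ξ ℙ) := Measure.isProbabilityMeasure_map hξ.aemeasurable
    have hprod := (indepFun_iff_map_prod_eq_prod_map_map he.aemeasurable hξ.aemeasurable).mp hindep
    rw [← lintegral_map (μ := ℙ) (g := fun ω => (e ω, ξ ω)) hFm (he.prodMk hξ), hprod,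
      lintegral_prod_symm _ hFm.aemeasurable, lintegral_map hFm.lintegral_prod_left' hξ]
    calc _ ≤ ∫⁻ ω, ENNReal.ofReal (12 / n * τ^2 * a * Mf (ξ ω)^2) ∂ℙ := by
          refine lintegral_mono fun ω => ?_
          have m1 : Measurable (fun v : Fin n → ℝ => f (z + τ • v) (ξ ω)) :=
            hf.comp (f := fun v : (Fin n → ℝ) => (z + τ • v, ξ ω)) (by fun_prop)
          have := cs_bd μ (by omega) hs hr q a hq ha hI (fun v => f (z + τ • v) (ξ ω)) m1
            (τ * Mf (ξ ω)) (mul_nonneg hτ.le (hMf _)) (fun x y => by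
              refine (hLip _ _ _).trans (le_of_eq ?_)
              have : (z + τ • x) - (z + τ • y) = τ • (x - y) := by rw [smul_sub]; abel
              rw [this]
              unfold l2norm
              simp only [Pi.smul_apply, smul_eq_mul, mul_pow, ← Finset.mul_sum]
              rw [Real.sqrt_mul (by positivity), Real.sqrt_sq hτ.le]; ring)
          simp only [smul_neg, ← sub_eq_add_neg] at this
          refine this.trans (le_of_eq ?_)
          congr 1; ring
      _ = _ := by
          rw [← ofReal_integral_eq_lintegral_ofReal (hMint.const_mul _)
            (Filter.Eventually.of_forall fun ω => by simp only [Pi.zero_apply]; positivity), integral_const_mul, hMmom]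
  have hD : ∫⁻ ω, ENNReal.ofReal (lpnorm q (e ω) ^ 2) ∂ℙ ≤ ENNReal.ofReal a := by
    have := N2_bd μ hs q a hq ha hI
    rwa [hμ, lintegral_map ((lpn_meas q).pow_const 2).ennreal_ofReal he] at this
  have hpt : ∀ ω, lpnorm q (g ω) ^ 2 ≤ n^2/(2*τ^2) * ((f (z + τ • e ω) (ξ ω) - f (z - τ • e ω) (ξ ω))^2 * lpnorm q (e ω) ^ 2)
      + 2*n^2*Δ^2/τ^2 * lpnorm q (e ω) ^ 2 := by
    intro ω
    set c := (n:ℝ) / (2 * τ) * ((f (z + τ • e ω) (ξ ω) + δ (z + τ • e ω))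
          - (f (z - τ • e ω) (ξ ω) + δ (z - τ • e ω))) with hc
    have h1 : lpnorm q (g ω) = |c| * lpnorm q (e ω) := by
      refine lpn_smul q c (by linarith) _ _ fun i => ?_
      rw [hg]
      simp only [← hc]
      split_ifs <;> simp [abs_mul]
    rw [h1, mul_pow, sq_abs]
    set F := f (z + τ • e ω) (ξ ω) - f (z - τ • e ω) (ξ ω) with hFd
    set D := δ (z + τ • e ω) - δ (z - τ • e ω) with hDd
    have hcc : c = (n:ℝ) / (2 * τ) * (F + D) := by rw [hc, hFd, hDd]; ring
    have hDb : D^2 ≤ (2*Δ)^2 := by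
      have b1 := abs_le.mp (hδ (z + τ • e ω))
      have b2 := abs_le.mp (hδ (z - τ • e ω))
      apply sq_le_sq'
      · rw [hDd]; linarith [b1.1, b2.2]
      · rw [hDd]; linarith [b1.2, b2.1]
    have h2 : c^2 ≤ n^2/(2*τ^2) * F^2 + 2*n^2*Δ^2/τ^2 := by
      have : (F+D)^2 ≤ 2*F^2 + 8*Δ^2 := by nlinarith [sq_nonneg (F-D)]
      calc c^2 = (n / (2*τ))^2 * (F+D)^2 := by rw [hcc]; ring
        _ ≤ (n / (2*τ))^2 * (2*F^2 + 8*Δ^2) := by gcongr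
        _ = _ := by field_simp; ring
    have := mul_le_mul_of_nonneg_right h2 (sq_nonneg (lpnorm q (e ω)))
    linarith
  have m2 : Measurable fun ω => ENNReal.ofReal (lpnorm q (e ω) ^ 2) :=
    (((lpn_meas q).comp he).pow_const 2).ennreal_ofReal
  have hfin := asm_bd ℙ (fun ω => (f (z + τ • e ω) (ξ ω) - f (z - τ • e ω) (ξ ω))^2 * lpnorm q (e ω) ^ 2)
    (fun ω => lpnorm q (e ω) ^ 2) (fun ω => lpnorm q (g ω) ^ 2) (n^2/(2*τ^2)) (2*n^2*Δ^2/τ^2)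
    (12 / n * τ^2 * a * M^2) a (by positivity) (by positivity) (by positivity) ha.le
    (fun ω => by positivity) (fun ω => by positivity) (fun ω => by positivity) m2 hpt hF hD
  refine hfin.trans (le_of_eq ?_)
  clear * - hn0 hτ
  field_simp
  ring

/-- second-moment bound for the zeroth-order oracle, Lemma 1:
`n = n_x + n_y ≥ 3`, `q ∈ [2, ∞)`, `e` uniform on the Euclidean unit sphere of `ℝ^n`, `ξ` a random
element independent of `e`, `f(·, ξ)` `M(ξ)`-Lipschitz w.r.t. `‖·‖₂` with `E[M(ξ)²] = M²`,
`|δ| ≤ Δ`, and `g = (n/(2τ))·(f(z + τe, ξ) + δ(z + τe) − f(z − τe, ξ) − δ(z − τe))·ẽ` where `ẽ`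
negates the last `n_y` coordinates of `e`. Then
`E[‖g‖_q²] ≤ 2·(3·n·M² + n²Δ²/τ²)·a_q²` with `a_q² = min{2q − 1, 32 log n − 8}·n^{2/q−1}`. -/
theorem statement1 (nx ny : ℕ) (hn : 3 ≤ nx + ny) (q : ℝ) (hq : 2 ≤ q)
    (z : Fin (nx + ny) → ℝ) (τ : ℝ) (hτ : 0 < τ) (Δ : ℝ) (hΔ : 0 ≤ Δ)
    {Ω : Type*} [MeasureSpace Ω] [IsProbabilityMeasure (ℙ : Measure Ω)]
    {Ξ : Type*} [MeasurableSpace Ξ]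
    (e : Ω → Fin (nx + ny) → ℝ) (he : Measurable e)
    (hsphere : ∀ᵐ ω ∂ℙ, ∑ i, (e ω i) ^ 2 = 1)
    (hrot : ∀ O ∈ Matrix.orthogonalGroup (Fin (nx + ny)) ℝ,
      Measure.map (fun ω => Matrix.mulVec O (e ω)) ℙ = Measure.map e ℙ)
    (ξ : Ω → Ξ) (hξ : Measurable ξ)
    (hindep : IndepFun e ξ ℙ)
    (f : (Fin (nx + ny) → ℝ) → Ξ → ℝ)
    (hf : Measurable (fun p : (Fin (nx + ny) → ℝ) × Ξ => f p.1 p.2))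
    (Mf : Ξ → ℝ) (hMf : ∀ x, 0 ≤ Mf x)
    (hLip : ∀ x z₁ z₂, |f z₁ x - f z₂ x| ≤ Mf x * l2norm (z₁ - z₂))
    (M : ℝ) (hM : 0 ≤ M)
    (hMint : Integrable (fun ω => (Mf (ξ ω)) ^ 2) ℙ)
    (hMmom : ∫ ω, (Mf (ξ ω)) ^ 2 ∂ℙ = M ^ 2)
    (δ : (Fin (nx + ny) → ℝ) → ℝ) (hδm : Measurable δ) (hδ : ∀ z', |δ z'| ≤ Δ)
    (g : Ω → Fin (nx + ny) → ℝ)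
    (hg : ∀ ω, g ω = fun (i : Fin (nx + ny)) =>
      ((nx + ny : ℝ) / (2 * τ)) *
        ((f (z + τ • e ω) (ξ ω) + δ (z + τ • e ω))
          - (f (z - τ • e ω) (ξ ω) + δ (z - τ • e ω))) *
        (if i.val < nx then e ω i else -(e ω i))) :
    ∫ ω, (lpnorm q (g ω)) ^ 2 ∂ℙ ≤
      2 * (3 * (nx + ny) * M ^ 2 + (nx + ny : ℝ) ^ 2 * Δ ^ 2 / τ ^ 2) *
        (min (2 * q - 1) (32 * Real.log (nx + ny) - 8) * (nx + ny : ℝ) ^ (2 / q - 1)) := by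
  exact main_aux nx ny hn q hq z τ hτ Δ hΔ e he hsphere hrot ξ hξ hindep f hf Mf hMf hLip M hM hMint hMmom
    δ hδm hδ g hg
end

section
/- Let X ⊂ ℝ^{n_x} and Y ⊂ ℝ^{n_y} be compact convex sets and Z = X × Y. Let φ : Z → ℝ and let φ̂ : Z → ℝ be differentiable, convex in x for each fixed y and concave in y for each fixed x, and suppose sup_{z ∈ Z} |φ̂(z) − φ(z)| ≤ τ·M for some τ, M ≥ 0. Let z_k = (x_k, y_k) ∈ Z for k = 1, …, N, let γ_1, …, γ_N > 0, Γ_N = ∑_{k=1}^N γ_k, and z̄_N = (x̄_N, ȳ_N) = (1/Γ_N)·∑_{k=1}^N γ_k·z_k. Write ∇̃φ̂(z) = (∇_x φ̂(x, y), −∇_y φ̂(x, y)) ∈ ℝ^{n_x + n_y}. Then the saddle-point residual satisfies ε_sad(z̄_N) := max_{y' ∈ Y} φ(x̄_N, y') − min_{x' ∈ X} φ(x', ȳ_N) ≤ max_{u ∈ Z} (1/Γ_N)·∑_{k=1}^N γ_k·⟨∇̃φ̂(z_k), z_k − u⟩ + 2·τ·M. -/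
open MeasureTheory

/-- The standard inner product `⟨a, b⟩ = ∑ i, a i * b i` on `ℝ^m`. -/
noncomputable def rdot {m : ℕ} (a b : Fin m → ℝ) : ℝ := ∑ i, a i * b i

/-- The continuous linear functional `v ↦ ∑ i, a i * v i` on `ℝ^m`. -/
noncomputable def toCLM {m : ℕ} (a : Fin m → ℝ) : (Fin m → ℝ) →L[ℝ] ℝ :=
  LinearMap.toContinuousLinearMap
    (∑ i, a i • (LinearMap.proj i : (Fin m → ℝ) →ₗ[ℝ] ℝ))

theorem toCLM_apply_aux {m : ℕ} (a v : Fin m → ℝ) : toCLM a v = rdot a v := by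
  simp [toCLM, rdot]

theorem grad_ineq_aux {m : ℕ} {S : Set (Fin m → ℝ)} {f : (Fin m → ℝ) → ℝ} {a x y : Fin m → ℝ}
    (hf : ConvexOn ℝ S f) (hx : x ∈ S) (hy : y ∈ S)
    (hd : HasFDerivWithinAt f (toCLM a) S x) : f x - f y ≤ rdot a (x - y) := by
  have hseg : ∀ t ∈ Set.Icc (0:ℝ) 1, AffineMap.lineMap x y t ∈ S := fun t ht =>
    hf.1.lineMap_mem hx hy ht
  have hg : ConvexOn ℝ (Set.Icc (0:ℝ) 1) (f ∘ (AffineMap.lineMap x y : ℝ →ᵃ[ℝ] _)) :=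
    (hf.comp_affineMap _).subset hseg (convex_Icc 0 1)
  have hl : HasDerivWithinAt (AffineMap.lineMap x y : ℝ → _) (y - x) (Set.Icc (0:ℝ) 1) 0 :=
    AffineMap.hasDerivWithinAt_lineMap
  have hd' : HasFDerivWithinAt f (toCLM a) S ((AffineMap.lineMap x y : ℝ → _) 0) := by
    simpa using hd
  have h1 := hd'.comp_hasDerivWithinAt (0:ℝ) hl hseg
  have h2 := hg.le_slope_of_hasDerivWithinAt (x := 0) (y := 1) (by simp) (by simp) one_pos h1
  rw [toCLM_apply_aux] at h2
  simp [slope_def_field] at h2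
  have h3 : rdot a (y - x) = - rdot a (x - y) := by
    simp [rdot, ← Finset.sum_neg_distrib]
    exact Finset.sum_congr rfl fun i _ => by ring
  linarith

/-- saddle-point residual via the smoothed function: `X, Y` compact convex,
`φ̂` differentiable (partial gradients `gx`, `gy`) convex-concave with
`sup_Z |φ̂ − φ| ≤ τM`, iterates `z_k = (x_k, y_k) ∈ Z`, weights `γ_k > 0` with sum `Γ_N`, and
`z̄_N = (1/Γ_N)∑ γ_k z_k`. Then
`ε_sad(z̄_N) ≤ max_{u ∈ Z} (1/Γ_N)∑ γ_k⟨∇̃φ̂(z_k), z_k − u⟩ + 2τM`, where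
`∇̃φ̂ = (∇_x φ̂, −∇_y φ̂)`. -/
theorem statement6 (nx ny N : ℕ) (hN : 1 ≤ N)
    (X : Set (Fin nx → ℝ)) (Y : Set (Fin ny → ℝ))
    (hXc : IsCompact X) (hXconv : Convex ℝ X) (hXne : X.Nonempty)
    (hYc : IsCompact Y) (hYconv : Convex ℝ Y) (hYne : Y.Nonempty)
    (τ M : ℝ) (hτ : 0 ≤ τ) (hM : 0 ≤ M)
    (φ φhat : (Fin nx → ℝ) → (Fin ny → ℝ) → ℝ)
    (gx : (Fin nx → ℝ) → (Fin ny → ℝ) → Fin nx → ℝ)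
    (gy : (Fin nx → ℝ) → (Fin ny → ℝ) → Fin ny → ℝ)
    (hdiffx : ∀ x ∈ X, ∀ y ∈ Y,
      HasFDerivWithinAt (fun x' => φhat x' y) (toCLM (gx x y)) X x)
    (hdiffy : ∀ x ∈ X, ∀ y ∈ Y,
      HasFDerivWithinAt (fun y' => φhat x y') (toCLM (gy x y)) Y y)
    (hconv : ∀ y ∈ Y, ConvexOn ℝ X (fun x => φhat x y))
    (hconc : ∀ x ∈ X, ConcaveOn ℝ Y (fun y => φhat x y))
    (hclose : ∀ x ∈ X, ∀ y ∈ Y, |φhat x y - φ x y| ≤ τ * M)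
    (xk : ℕ → Fin nx → ℝ) (yk : ℕ → Fin ny → ℝ)
    (hxk : ∀ k, xk k ∈ X) (hyk : ∀ k, yk k ∈ Y)
    (γ : ℕ → ℝ) (hγ : ∀ k, 0 < γ k)
    (Γ : ℝ) (hΓ : Γ = ∑ k ∈ Finset.Icc 1 N, γ k)
    (xbar : Fin nx → ℝ) (ybar : Fin ny → ℝ)
    (hxbar : xbar = (1 / Γ) • ∑ k ∈ Finset.Icc 1 N, γ k • xk k)
    (hybar : ybar = (1 / Γ) • ∑ k ∈ Finset.Icc 1 N, γ k • yk k) :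
    (⨆ y' : Y, φ xbar y') - (⨅ x' : X, φ x' ybar) ≤
      (⨆ u : ↥(X ×ˢ Y), (1 / Γ) *
        ∑ k ∈ Finset.Icc 1 N, γ k *
          (rdot (gx (xk k) (yk k)) (xk k - (u : (Fin nx → ℝ) × (Fin ny → ℝ)).1)
            - rdot (gy (xk k) (yk k)) (yk k - (u : (Fin nx → ℝ) × (Fin ny → ℝ)).2)))
      + 2 * τ * M := by
  have hΓpos : 0 < Γ := by
    rw [hΓ]; exact Finset.sum_pos (fun k _ => hγ k) ⟨1, by simp [hN]⟩
  have hw0 : ∀ k ∈ Finset.Icc 1 N, 0 ≤ γ k / Γ := fun k _ => (div_pos (hγ k) hΓpos).le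
  have hw1 : ∑ k ∈ Finset.Icc 1 N, γ k / Γ = 1 := by
    rw [← Finset.sum_div, ← hΓ, div_self hΓpos.ne']
  have hxb : xbar = ∑ k ∈ Finset.Icc 1 N, (γ k / Γ) • xk k := by
    rw [hxbar, Finset.smul_sum]
    exact Finset.sum_congr rfl fun k _ => by rw [smul_smul]; congr 1; ring
  have hyb : ybar = ∑ k ∈ Finset.Icc 1 N, (γ k / Γ) • yk k := by
    rw [hybar, Finset.smul_sum]
    exact Finset.sum_congr rfl fun k _ => by rw [smul_smul]; congr 1; ring
  have hxbX : xbar ∈ X := hxb ▸ hXconv.sum_mem hw0 hw1 fun k _ => hxk k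
  have hybY : ybar ∈ Y := hyb ▸ hYconv.sum_mem hw0 hw1 fun k _ => hyk k
  set F : (Fin nx → ℝ) × (Fin ny → ℝ) → ℝ := fun u => (1 / Γ) *
        ∑ k ∈ Finset.Icc 1 N, γ k *
          (rdot (gx (xk k) (yk k)) (xk k - u.1) - rdot (gy (xk k) (yk k)) (yk k - u.2)) with hF
  have hFc : Continuous F := by
    simp only [hF, rdot]
    fun_prop
  have hbdd : BddAbove (Set.range fun u : ↥(X ×ˢ Y) => F u) := by
    have := ((hXc.prod hYc).image hFc).bddAbove
    rwa [Set.image_eq_range] at this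
  have key : ∀ x' ∈ X, ∀ y' ∈ Y, φ xbar y' - φ x' ybar ≤
      (⨆ u : ↥(X ×ˢ Y), F u) + 2 * τ * M := by
    intro x' hx' y' hy'
    have h1 : F (x', y') ≤ ⨆ u : ↥(X ×ˢ Y), F u := le_ciSup hbdd ⟨(x', y'), hx', hy'⟩
    have h2 := abs_le.1 (hclose xbar hxbX y' hy')
    have h3 := abs_le.1 (hclose x' hx' ybar hybY)
    have h4 : φhat xbar y' ≤ ∑ k ∈ Finset.Icc 1 N, (γ k / Γ) * φhat (xk k) y' := by
      rw [hxb]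
      exact (hconv y' hy').map_sum_le hw0 hw1 fun k _ => hxk k
    have h5 : ∑ k ∈ Finset.Icc 1 N, (γ k / Γ) * φhat x' (yk k) ≤ φhat x' ybar := by
      rw [hyb]
      exact (hconc x' hx').le_map_sum hw0 hw1 fun k _ => hyk k
    have h6 : ∑ k ∈ Finset.Icc 1 N, (γ k / Γ) * φhat (xk k) y'
        - ∑ k ∈ Finset.Icc 1 N, (γ k / Γ) * φhat x' (yk k) ≤ F (x', y') := by
      simp only [hF]
      rw [← Finset.sum_sub_distrib, Finset.mul_sum]
      refine Finset.sum_le_sum fun k hk => ?_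
      have a1 := grad_ineq_aux (hconv _ (hyk k)) (hxk k) hx' (hdiffx _ (hxk k) _ (hyk k))
      have hneg : HasFDerivWithinAt (-(fun y' => φhat (xk k) y'))
          (toCLM (-(gy (xk k) (yk k)))) Y (yk k) := by
        have e : toCLM (-(gy (xk k) (yk k))) = -toCLM (gy (xk k) (yk k)) := by
          ext v; simp [toCLM_apply_aux, rdot]
        rw [e]; exact (hdiffy _ (hxk k) _ (hyk k)).neg
      have a2 := grad_ineq_aux (hconc _ (hxk k)).neg (hyk k) hy' hneg
      have a3 : rdot (-(gy (xk k) (yk k))) (yk k - y') = - rdot (gy (xk k) (yk k)) (yk k - y') := by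
        simp [rdot]
      rw [a3] at a2
      simp only [Pi.neg_apply] at a2
      have := mul_le_mul_of_nonneg_left (add_le_add a1 a2) (hw0 k hk)
      calc _ = γ k / Γ * (φhat (xk k) (yk k) - φhat x' (yk k)
              + (-φhat (xk k) (yk k) - -φhat (xk k) y')) := by ring
        _ ≤ _ := this
        _ = _ := by ring
    linarith
  haveI : Nonempty X := hXne.to_subtype
  haveI : Nonempty Y := hYne.to_subtype
  rw [sub_le_comm]
  refine le_ciInf fun x' => ?_
  rw [sub_le_iff_le_add]
  refine ciSup_le fun y' => ?_
  have := key x' x'.2 y' y'.2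
  linarith
end

section
/- Let X ⊆ ℝ^{n_x} and Y ⊆ ℝ^{n_y} be nonempty compact sets, and let X^α ⊆ X and Y^α ⊆ Y be nonempty compact subsets. Let φ : X × Y → ℝ be M-Lipschitz with respect to the Euclidean norm on ℝ^{n_x + n_y}. Set r_x = max_{x ∈ X} min_{x̂ ∈ X^α} ‖x − x̂‖₂ and r_y = max_{y ∈ Y} min_{ŷ ∈ Y^α} ‖y − ŷ‖₂. If (x_k, y_k) ∈ X^α × Y^α satisfies max_{y ∈ Y^α} φ(x_k, y) − min_{x ∈ X^α} φ(x, y_k) ≤ ε/2, then max_{y ∈ Y} φ(x_k, y) − min_{x ∈ X} φ(x, y_k) ≤ ε/2 + (r_x + r_y)·M. -/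
theorem aux_near {E : Type*} [NormedAddCommGroup E] (S T : Set E) (hS : IsCompact S)
    (hT : IsCompact T) (hTne : T.Nonempty) (x : E) (hx : x ∈ S) :
    ∃ t ∈ T, ‖x - t‖ ≤ ⨆ x : S, ⨅ xh : T, ‖(x : E) - (xh : E)‖ := by
  obtain ⟨t, ht, hmin⟩ := hT.exists_isMinOn hTne
    (f := fun t => ‖x - t‖) (by fun_prop)
  refine ⟨t, ht, ?_⟩
  haveI : Nonempty T := hTne.to_subtype
  have h1 : ‖x - t‖ ≤ ⨅ xh : T, ‖x - (xh : E)‖ := le_ciInf fun u => hmin u.2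
  refine h1.trans ?_
  refine le_ciSup (f := fun x : S => ⨅ xh : T, ‖(x : E) - (xh : E)‖) ?_ ⟨x, hx⟩
  obtain ⟨C, hC⟩ := hS.isBounded.exists_norm_le
  refine ⟨C + ‖t‖, ?_⟩
  rintro _ ⟨u, rfl⟩
  have h2 : (⨅ xh : T, ‖(u : E) - (xh : E)‖) ≤ ‖(u : E) - t‖ :=
    ciInf_le (f := fun xh : T => ‖(u : E) - (xh : E)‖)
      ⟨0, by rintro _ ⟨v, rfl⟩; exact norm_nonneg _⟩ ⟨t, ht⟩
  have h3 := norm_sub_le (u : E) t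
  have h4 := hC u u.2
  show (⨅ xh : T, ‖(u : E) - (xh : E)‖) ≤ _
  linarith

theorem aux_sup {E : Type*} [NormedAddCommGroup E] (S T : Set E) (hS : IsCompact S)
    (hT : IsCompact T) (hTne : T.Nonempty) (hTS : T ⊆ S) (f : E → ℝ) (M : ℝ) (hM : 0 < M)
    (hf : ∀ x ∈ S, ∀ x' ∈ S, |f x - f x'| ≤ M * ‖x - x'‖) :
    (⨆ x : S, f x) ≤ (⨆ x : T, f x) + (⨆ x : S, ⨅ xh : T, ‖(x : E) - (xh : E)‖) * M := by
  haveI : Nonempty S := (hTne.mono hTS).to_subtype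
  have hc : ContinuousOn f T := by
    refine (LipschitzOnWith.of_dist_le_mul (K := ⟨M, hM.le⟩) ?_).continuousOn
    intro x hx y hy
    rw [Real.dist_eq, dist_eq_norm]
    exact hf x (hTS hx) y (hTS hy)
  have hb : BddAbove (Set.range fun x : T => f x) := by
    have := hT.bddAbove_image hc
    rwa [Set.image_eq_range] at this
  refine ciSup_le fun x => ?_
  obtain ⟨t, ht, hxt⟩ := aux_near S T hS hT hTne x x.2
  have h1 := le_ciSup hb ⟨t, ht⟩
  have h2 := (le_abs_self _).trans (hf x x.2 t (hTS ht))
  have h3 := mul_le_mul_of_nonneg_left hxt hM.le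
  simp only at h1
  linarith

/-- Lemma on solving a saddle-point problem over reduced sets:
`X ⊆ ℝ^{n_x}`, `Y ⊆ ℝ^{n_y}` nonempty compact, `X^α ⊆ X`, `Y^α ⊆ Y` nonempty compact,
`φ` `M`-Lipschitz w.r.t. the Euclidean norm on `ℝ^{n_x+n_y}`,
`r_x = max_{x ∈ X} min_{x̂ ∈ X^α} ‖x − x̂‖₂`, `r_y = max_{y ∈ Y} min_{ŷ ∈ Y^α} ‖y − ŷ‖₂`.
If `(x_k, y_k) ∈ X^α × Y^α` has duality gap `≤ ε/2` on `X^α × Y^α`, then its duality gap on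
`X × Y` is `≤ ε/2 + (r_x + r_y)M`. -/
theorem statement9 (nx ny : ℕ)
    (X Xα : Set (EuclideanSpace ℝ (Fin nx))) (Y Yα : Set (EuclideanSpace ℝ (Fin ny)))
    (hXc : IsCompact X) (hXne : X.Nonempty) (hXαc : IsCompact Xα) (hXαne : Xα.Nonempty)
    (hXsub : Xα ⊆ X)
    (hYc : IsCompact Y) (hYne : Y.Nonempty) (hYαc : IsCompact Yα) (hYαne : Yα.Nonempty)
    (hYsub : Yα ⊆ Y)
    (φ : EuclideanSpace ℝ (Fin nx) → EuclideanSpace ℝ (Fin ny) → ℝ) (M : ℝ) (hM : 0 < M)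
    (hLip : ∀ x ∈ X, ∀ x' ∈ X, ∀ y ∈ Y, ∀ y' ∈ Y,
      |φ x y - φ x' y'| ≤ M * Real.sqrt (‖x - x'‖ ^ 2 + ‖y - y'‖ ^ 2))
    (rx ry : ℝ)
    (hrx : rx = ⨆ x : X, ⨅ xh : Xα,
      ‖(x : EuclideanSpace ℝ (Fin nx)) - (xh : EuclideanSpace ℝ (Fin nx))‖)
    (hry : ry = ⨆ y : Y, ⨅ yh : Yα,
      ‖(y : EuclideanSpace ℝ (Fin ny)) - (yh : EuclideanSpace ℝ (Fin ny))‖)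
    (ε : ℝ) (xk : EuclideanSpace ℝ (Fin nx)) (yk : EuclideanSpace ℝ (Fin ny))
    (hxk : xk ∈ Xα) (hyk : yk ∈ Yα)
    (hsol : (⨆ y : Yα, φ xk y) - (⨅ x : Xα, φ x yk) ≤ ε / 2) :
    (⨆ y : Y, φ xk y) - (⨅ x : X, φ x yk) ≤ ε / 2 + (rx + ry) * M := by
  have hy := aux_sup Y Yα hYc hYαc hYαne hYsub (fun y => φ xk y) M hM (by
    intro y hy y' hy'
    have := hLip xk (hXsub hxk) xk (hXsub hxk) y hy y' hy'
    simpa using this)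
  have hx := aux_sup X Xα hXc hXαc hXαne hXsub (fun x => -φ x yk) M hM (by
    intro x hx x' hx'
    have := hLip x' hx' x hx yk (hYsub hyk) yk (hYsub hyk)
    rw [norm_sub_rev x x', show -φ x yk - -φ x' yk = φ x' yk - φ x yk by ring]
    simpa using this)
  rw [← hry] at hy
  rw [← hrx] at hx
  have e (S : Set (EuclideanSpace ℝ (Fin nx))) :
      (⨆ x : S, -φ x yk) = -(⨅ x : S, φ x yk) := by
    rw [iInf, Real.sInf_def, neg_neg, iSup]
    congr 1
    ext z
    simp [neg_eq_iff_eq_neg]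
  simp only [e] at hx
  linarith
end
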